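/- Let H be a real Hilbert space, A : H → H a continuous self-adjoint nonnegative linear operator, 0 ≤ p ≤ 1, γ ≥ 1, and u₀, u₁ ∈ H with ⟨Au₀,u₀⟩ > 0. Let u be the global solution of the parabolic problem u'(t) + (1+t)^{p} ⟨Au(t),u(t)⟩^γ A u(t) = 0, u(0) = u₀. Then there exist ε₀ > 0 and a constant C₃ > 0 such that for every ε ∈ (0,ε₀) and every global C² solution u_ε of the hyperbolic problem ε u_ε'' + (1+t)^{-p} u_ε' + ⟨Au_ε,u_ε⟩^γ A u_ε = 0 with u_ε(0) = u₀, u_ε'(0) = u₁, setting ρ_ε := u_ε − u and r_ε := u_ε − u − θ_ε (θ_ε the corrector), one has for all t ≥ 0: |ρ_ε(t)|² + ⟨Aρ_ε(t),ρ_ε(t)⟩ + ∫₀^t |r_ε'(s)|² ⟨Au(s),u(s)⟩^{-γ} (1+s)^{-p} ds ≤ C₃ ε. -/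

import Mathlib

open Real MeasureTheory intervalIntegral
open scoped RealInnerProductSpace

/-- `u` (with derivatives `u'`, `u''`) is a global C² solution on `[0,∞)` of the
hyperbolic Cauchy problem
`ε u'' + (1+t)^{-p} u' + ⟨Au,u⟩^γ A u = 0`, `u(0) = u₀`, `u'(0) = u₁`. -/
def IsHypSolution {H : Type*} [NormedAddCommGroup H] [InnerProductSpace ℝ H]
    (A : H →L[ℝ] H) (p γ ε : ℝ) (u₀ u₁ : H) (u u' u'' : ℝ → H) : Prop :=
  u 0 = u₀ ∧ u' 0 = u₁ ∧
  (∀ t ∈ Set.Ici (0:ℝ), HasDerivWithinAt u (u' t) (Set.Ici 0) t) ∧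
  (∀ t ∈ Set.Ici (0:ℝ), HasDerivWithinAt u' (u'' t) (Set.Ici 0) t) ∧
  ContinuousOn u'' (Set.Ici 0) ∧
  (∀ t ∈ Set.Ici (0:ℝ),
    ε • u'' t + ((1+t) ^ (-p)) • u' t + (⟪A (u t), u t⟫ ^ γ) • A (u t) = 0)

/-- `u` (with derivative `u'`) is a global C¹ solution on `[0,∞)` of the parabolic
Cauchy problem `u' + (1+t)^{p} ⟨Au,u⟩^γ A u = 0`, `u(0) = u₀`. -/
def IsParSolution {H : Type*} [NormedAddCommGroup H] [InnerProductSpace ℝ H]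
    (A : H →L[ℝ] H) (p γ : ℝ) (u₀ : H) (u u' : ℝ → H) : Prop :=
  u 0 = u₀ ∧
  (∀ t ∈ Set.Ici (0:ℝ), HasDerivWithinAt u (u' t) (Set.Ici 0) t) ∧
  ContinuousOn u' (Set.Ici 0) ∧
  (∀ t ∈ Set.Ici (0:ℝ),
    u' t + ((1+t) ^ p * ⟪A (u t), u t⟫ ^ γ) • A (u t) = 0)

/-- `θ` (with derivatives `θ'`, `θ''`) is the corrector: the solution of
`ε θ'' + (1+t)^{-p} θ' = 0`, `θ(0) = 0`, `θ'(0) = w₀`. -/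
def IsCorrector {H : Type*} [NormedAddCommGroup H] [InnerProductSpace ℝ H]
    (p ε : ℝ) (w₀ : H) (θ θ' θ'' : ℝ → H) : Prop :=
  θ 0 = 0 ∧ θ' 0 = w₀ ∧
  (∀ t ∈ Set.Ici (0:ℝ), HasDerivWithinAt θ (θ' t) (Set.Ici 0) t) ∧
  (∀ t ∈ Set.Ici (0:ℝ), HasDerivWithinAt θ' (θ'' t) (Set.Ici 0) t) ∧
  (∀ t ∈ Set.Ici (0:ℝ), ε • θ'' t + ((1+t) ^ (-p)) • θ' t = 0)

/-- A constant upper barrier: `f` stays below `M` if it is strictly decreasing whenever it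
touches `M`. -/
theorem le_of_deriv_neg_at_level {f f' : ℝ → ℝ} {T M : ℝ} (hT : 0 ≤ T)
    (hc : ContinuousOn f (Set.Icc 0 T))
    (hd : ∀ t ∈ Set.Ico 0 T, HasDerivWithinAt f (f' t) (Set.Ici 0) t)
    (h0 : f 0 ≤ M) (hneg : ∀ t ∈ Set.Ico 0 T, f t = M → f' t < 0) : f T ≤ M :=
  image_le_of_deriv_right_lt_deriv_boundary' (B := fun _ => M) (B' := fun _ => 0) hc
    (fun t ht => (hd t ht).mono (Set.Ici_subset_Ici.2 ht.1)) h0 continuousOn_const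
    (fun t _ => hasDerivWithinAt_const t _ M) hneg (Set.right_mem_Icc.2 hT)

theorem le_initial_of_deriv_nonpos {f f' : ℝ → ℝ} {T : ℝ} (hT : 0 ≤ T)
    (hc : ContinuousOn f (Set.Icc 0 T))
    (hd : ∀ t ∈ Set.Ico 0 T, HasDerivWithinAt f (f' t) (Set.Ici 0) t)
    (hneg : ∀ t ∈ Set.Ico 0 T, f' t ≤ 0) : f T ≤ f 0 :=
  image_le_of_deriv_right_le_deriv_boundary (B := fun _ => f 0) (B' := fun _ => 0) hc
    (fun t ht => (hd t ht).mono (Set.Ici_subset_Ici.2 ht.1)) le_rfl continuousOn_const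
    (fun t _ => hasDerivWithinAt_const t _ (f 0)) hneg (Set.right_mem_Icc.2 hT)

theorem le_initial_of_deriv_nonpos_Ici {f f' : ℝ → ℝ}
    (hd : ∀ t, 0 ≤ t → HasDerivWithinAt f (f' t) (Set.Ici 0) t)
    (hneg : ∀ t, 0 ≤ t → f' t ≤ 0) {T : ℝ} (hT : 0 ≤ T) : f T ≤ f 0 :=
  le_initial_of_deriv_nonpos hT
    (fun t ht => (hd t ht.1).continuousWithinAt.mono Set.Icc_subset_Ici_self)
    (fun t ht => hd t ht.1) (fun t ht => hneg t ht.1)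

/-- Continuation principle on `[0, ∞)`. -/
theorem forall_nonneg_of_continuation {G : ℝ → Prop}
    (hclosed : ∀ T, 0 ≤ T → (∀ s, 0 ≤ s → s < T → G s) → G T)
    (hopen : ∀ T, 0 ≤ T → G T → ∀ᶠ s in nhdsWithin T (Set.Ici 0), G s) :
    ∀ t, 0 ≤ t → G t := by
  by_contra! hcon
  obtain ⟨t₁, ht₁, hGt₁⟩ := hcon
  set B : Set ℝ := {t | 0 ≤ t ∧ ¬ G t}
  have hne : B.Nonempty := ⟨t₁, ht₁, hGt₁⟩
  have hbdd : BddBelow B := ⟨0, fun t ht => ht.1⟩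
  have hT0 : 0 ≤ sInf B := le_csInf hne fun t ht => ht.1
  have hlt : ∀ s, 0 ≤ s → s < sInf B → G s := fun s hs hsT => by
    by_contra hG
    exact absurd (csInf_le hbdd ⟨hs, hG⟩) (not_le.2 hsT)
  have hGT := hclosed _ hT0 hlt
  obtain ⟨δ, hδ, hball⟩ := Metric.mem_nhdsWithin_iff.1 (hopen _ hT0 hGT)
  obtain ⟨s, hs, hsδ⟩ := exists_lt_of_csInf_lt hne (lt_add_of_pos_right (sInf B) hδ)
  refine hs.2 (hball ⟨?_, hs.1⟩)
  rw [Metric.mem_ball, Real.dist_eq, abs_of_nonneg (sub_nonneg.2 (csInf_le hbdd hs))]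
  linarith

theorem hasDerivWithinAt_one_add_rpow (p : ℝ) {t : ℝ} (ht : 0 ≤ t) :
    HasDerivWithinAt (fun s : ℝ => (1 + s) ^ p) (p * (1 + t) ^ p / (1 + t)) (Set.Ici 0) t := by
  have h1 : (0 : ℝ) < 1 + t := by linarith
  have h : HasDerivAt (fun s : ℝ => (1 + s) ^ p) (1 * p * (1 + t) ^ (p - 1)) t :=
    ((hasDerivAt_id t).const_add 1).rpow_const (Or.inl h1.ne')
  refine (h.congr_deriv ?_).hasDerivWithinAt
  rw [Real.rpow_sub_one h1.ne']; ring

theorem one_le_one_add_rpow {p t : ℝ} (hp : 0 ≤ p) (ht : 0 ≤ t) : 1 ≤ (1 + t) ^ p :=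
  Real.one_le_rpow (by linarith) hp

theorem one_add_rpow_le {p t : ℝ} (hp : p ≤ 1) (ht : 0 ≤ t) : (1 + t) ^ p ≤ 1 + t := by
  simpa using Real.rpow_le_rpow_of_exponent_le (show (1 : ℝ) ≤ 1 + t by linarith) hp

/-- Mean value bound for `x ↦ x ^ γ`. -/
theorem rpow_sub_rpow_le {γ x y : ℝ} (hγ : 1 ≤ γ) (hy : 0 ≤ y) (hx : 0 < x) :
    x ^ γ - y ^ γ ≤ γ * (x ^ γ / x) * (x - y) := by
  have h := one_add_mul_self_le_rpow_one_add (s := y / x - 1) (p := γ)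
    (by have := div_nonneg hy hx.le; linarith) hγ
  rw [add_sub_cancel, Real.div_rpow hy hx.le] at h
  have hxγ : 0 < x ^ γ := Real.rpow_pos_of_pos hx γ
  have h2 := mul_le_mul_of_nonneg_right h hxγ.le
  rw [div_mul_cancel₀ _ hxγ.ne'] at h2
  have : γ * (x ^ γ / x) * (x - y) = x ^ γ - (1 + γ * (y / x - 1)) * x ^ γ := by
    field_simp; ring
  linarith

section NonnegOperator

variable {H : Type*} [NormedAddCommGroup H] [InnerProductSpace ℝ H] {A : H →L[ℝ] H}

theorem inner_map_sq_le (hsa : ∀ x y : H, ⟪A x, y⟫ = ⟪x, A y⟫) (hnn : ∀ x : H, 0 ≤ ⟪A x, x⟫)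
    (x y : H) : ⟪A x, y⟫ ^ 2 ≤ ⟪A x, x⟫ * ⟪A y, y⟫ := by
  have h : ∀ s : ℝ, 0 ≤ ⟪A y, y⟫ * (s * s) + 2 * ⟪A x, y⟫ * s + ⟪A x, x⟫ := fun s => by
    have := hnn (x + s • y)
    have hxy : ⟪A y, x⟫ = ⟪A x, y⟫ := by rw [hsa, real_inner_comm]
    simp only [map_add, map_smul, inner_add_left, inner_add_right, real_inner_smul_left,
      real_inner_smul_right, hxy] at this
    linarith
  have := discrim_le_zero h
  rw [discrim] at this
  linarith

theorem norm_map_sq_le (hsa : ∀ x y : H, ⟪A x, y⟫ = ⟪x, A y⟫) (hnn : ∀ x : H, 0 ≤ ⟪A x, x⟫)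
    (x : H) : ‖A x‖ ^ 2 ≤ ‖A‖ * ⟪A x, x⟫ := by
  have h1 := inner_map_sq_le hsa hnn x (A x)
  have h2 : ⟪A (A x), A x⟫ ≤ ‖A‖ * ‖A x‖ ^ 2 := by
    calc ⟪A (A x), A x⟫ ≤ ‖A (A x)‖ * ‖A x‖ := real_inner_le_norm _ _
      _ ≤ ‖A‖ * ‖A x‖ * ‖A x‖ := by gcongr; exact A.le_opNorm _
      _ = _ := by ring
  rw [real_inner_self_eq_norm_sq] at h1
  rcases (sq_nonneg ‖A x‖).eq_or_lt with h0 | h0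
  · rw [← h0]; exact mul_nonneg (norm_nonneg _) (hnn x)
  · refine le_of_mul_le_mul_right ?_ h0
    have := mul_le_mul_of_nonneg_left h2 (hnn x)
    nlinarith

theorem inner_map_self_le (x : H) : ⟪A x, x⟫ ≤ ‖A‖ * ‖x‖ ^ 2 := by
  calc ⟪A x, x⟫ ≤ ‖A x‖ * ‖x‖ := real_inner_le_norm _ _
    _ ≤ ‖A‖ * ‖x‖ * ‖x‖ := by gcongr; exact A.le_opNorm _
    _ = _ := by ring

/-- Quantitative monotonicity of `x ↦ ⟪A x, x⟫ ^ γ • A x`. -/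
theorem half_mul_inner_le_inner_sub (hsa : ∀ x y : H, ⟪A x, y⟫ = ⟪x, A y⟫)
    (hnn : ∀ x : H, 0 ≤ ⟪A x, x⟫) {γ : ℝ} (hγ : 0 ≤ γ) (x y : H) :
    (⟪A x, x⟫ ^ γ + ⟪A y, y⟫ ^ γ) / 2 * ⟪A (x - y), x - y⟫
      ≤ ⟪⟪A x, x⟫ ^ γ • A x - ⟪A y, y⟫ ^ γ • A y, x - y⟫ := by
  have hxy : ⟪A y, x⟫ = ⟪A x, y⟫ := by rw [hsa, real_inner_comm]
  have hmono : 0 ≤ (⟪A x, x⟫ ^ γ - ⟪A y, y⟫ ^ γ) * (⟪A x, x⟫ - ⟪A y, y⟫) := by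
    rcases le_total ⟪A x, x⟫ ⟪A y, y⟫ with h | h
    · have := Real.rpow_le_rpow (hnn x) h hγ
      exact mul_nonneg_of_nonpos_of_nonpos (by linarith) (by linarith)
    · have := Real.rpow_le_rpow (hnn y) h hγ
      exact mul_nonneg (by linarith) (by linarith)
  simp only [map_sub, inner_sub_left, inner_sub_right, real_inner_smul_left, hxy]
  linarith

end NonnegOperator


set_option maxHeartbeats 400000 in
theorem level_deriv_neg_of_bounds {p γ ε w s y n h V K M : ℝ} (hp0 : 0 ≤ p) (hp1 : p ≤ 1)
    (hγ : 1 ≤ γ) (hε : 0 < ε) (hw : 1 ≤ w) (hws : w ≤ s) (hn : 0 ≤ n) (hV : 0 ≤ V)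
    (hhV : h ^ 2 ≤ V * y) (hVs : V * s ≤ K * w) (hy : y * w * s ≤ K) (hh : |h| * s ≤ K)
    (hK : 10 * (γ + 2) ^ 2 * K * ε ≤ 1) (hM : 5 ≤ M)
    (hZ : y * (1 + 2 * γ * ε * (w * h)) * (w * s) = M) :
    ((2 * γ * h * y - 2 * n / w - 2 * ε * (γ + 2) * h * n) * (1 + 2 * γ * ε * (w * h))
      + y * (2 * γ * ε * (p * w / s * h + w * ((-h / w - y + 2 * ε * n - ε * h ^ 2) / ε))))
        * (w * s) + y * (1 + 2 * γ * ε * (w * h)) * ((p + 1) * w) < 0 := by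
  have hw0 : 0 < w := by linarith
  have hs0 : 0 < s := by linarith
  have hK0 : 0 ≤ K := le_trans (by positivity) hh
  have hεK : 0 ≤ ε * K := by positivity
  -- smallness of `ε w h`
  have hwh : |w * h| ≤ K := by
    rw [abs_mul, abs_of_pos hw0]
    nlinarith [abs_nonneg h]
  obtain ⟨hwh1, hwh2⟩ := abs_le.1 hwh
  obtain ⟨hh1, hh2⟩ : -(K / s) ≤ h ∧ h ≤ K / s := abs_le.1 ((le_div_iff₀ hs0).2 hh)
  have hγε : 30 * (γ + 2) * (ε * K) ≤ 1 := by nlinarith [mul_nonneg hεK (by linarith : 0 ≤ γ + 2)]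
  have hγε2 : 10 * γ ^ 2 * (ε * K) ≤ 1 := by nlinarith
  have hγε1 : 30 * (γ * (ε * K)) ≤ 1 := by nlinarith
  have e1 : |2 * γ * ε * (w * h)| ≤ 1 / 10 := by
    rw [abs_mul, abs_of_nonneg (by positivity)]
    nlinarith [mul_le_mul_of_nonneg_left hwh (by positivity : 0 ≤ γ * ε)]
  have e2 : |ε * (γ + 2) * (w * h)| ≤ 1 / 10 := by
    rw [abs_mul, abs_of_nonneg (by positivity)]
    nlinarith [mul_le_mul_of_nonneg_left hwh (by positivity : 0 ≤ (γ + 2) * ε)]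
  obtain ⟨e1l, e1u⟩ := abs_le.1 e1
  obtain ⟨e2l, e2u⟩ := abs_le.1 e2
  have hy0 : 0 < y := by
    by_contra hcon
    have : y * (1 + 2 * γ * ε * (w * h)) * (w * s) ≤ 0 := by
      have : 0 ≤ -y * (1 + 2 * γ * ε * (w * h)) * (w * s) :=
        mul_nonneg (mul_nonneg (by linarith) (by linarith)) (by positivity)
      linarith
    linarith
  have hVK : V ≤ K := by
    by_contra hcon
    nlinarith
  -- exact rewriting of the derivative
  set E := 2 * γ * ε * (w * h) with hE
  set e := ε * (γ + 2) * (w * h) with he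
  have key : (2 * γ * h * y - 2 * n / w - 2 * ε * (γ + 2) * h * n) * (1 + E)
      + y * (2 * γ * ε * (p * w / s * h + w * ((-h / w - y + 2 * ε * n - ε * h ^ 2) / ε)))
      = -2 * γ * w * y ^ 2 + (4 * γ ^ 2 - 2 * γ) * ε * w * h ^ 2 * y
        + n / w * (-2 * (1 + E) * (1 + e) + 4 * γ * ε * w * (w * y))
        + 2 * p * γ * ε * (w * h) * y / s := by
    rw [hE, he]; field_simp; ring
  rw [key]
  have t2 : (4 * γ ^ 2 - 2 * γ) * ε * w * h ^ 2 * y ≤ 1 / 2 * (w * y ^ 2) := by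
    calc (4 * γ ^ 2 - 2 * γ) * ε * w * h ^ 2 * y ≤ 4 * γ ^ 2 * ε * w * (K * y) * y := by
          gcongr
          · linarith
          · exact hhV.trans (by gcongr)
      _ = 4 * γ ^ 2 * (ε * K) * (w * y ^ 2) := by ring
      _ ≤ 1 / 2 * (w * y ^ 2) := by gcongr; linarith
  have hwy : w * (w * y) ≤ K := by
    calc w * (w * y) ≤ s * (w * y) := by gcongr
      _ = y * w * s := by ring
      _ ≤ K := hy
  have t3 : n / w * (-2 * (1 + E) * (1 + e) + 4 * γ * ε * w * (w * y)) ≤ 0 := by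
    apply mul_nonpos_of_nonneg_of_nonpos (by positivity)
    have h1 : 4 * γ * ε * w * (w * y) ≤ 4 * (γ * (ε * K)) := by
      calc 4 * γ * ε * w * (w * y) = 4 * γ * ε * (w * (w * y)) := by ring
        _ ≤ 4 * γ * ε * K := by gcongr
        _ = _ := by ring
    have h2 : (9 / 10 : ℝ) * (9 / 10) ≤ (1 + E) * (1 + e) :=
      mul_le_mul (by linarith) (by linarith) (by norm_num) (by linarith)
    linarith
  have t4 : 2 * p * γ * ε * (w * h) * y / s ≤ y / s := by
    have : 2 * p * γ * ε * (w * h) = p * E := by rw [hE]; ring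
    rw [this]
    have hpE : p * E ≤ 1 := by
      calc p * E ≤ p * (1 / 10) := by gcongr
        _ ≤ 1 := by linarith
    have := mul_le_mul_of_nonneg_right hpE hy0.le
    gcongr
    linarith
  have hlow : M ≤ 11 / 10 * (y * (w * s)) := by
    rw [← hZ]
    have h1 : 0 ≤ y * (w * s) := by positivity
    have h2 := mul_le_mul_of_nonneg_left (by linarith : 1 + E ≤ 11 / 10) h1
    linarith
  have hγ2 : -2 * γ * w * y ^ 2 ≤ -2 * (w * y ^ 2) := by
    have h1 : 0 ≤ w * y ^ 2 := by positivity
    have h2 := mul_le_mul_of_nonneg_right hγ h1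
    linarith
  have total : (-2 * γ * w * y ^ 2 + (4 * γ ^ 2 - 2 * γ) * ε * w * h ^ 2 * y
        + n / w * (-2 * (1 + E) * (1 + e) + 4 * γ * ε * w * (w * y))
        + 2 * p * γ * ε * (w * h) * y / s) * (w * s)
        ≤ (-(w * y ^ 2) + y / s) * (w * s) := by
    have : 0 ≤ w * y ^ 2 := by positivity
    gcongr
    linarith
  have eq1 : (-(w * y ^ 2) + y / s) * (w * s) = w * y * (1 - y * (w * s)) := by
    field_simp; ring
  have t5 : y * (1 + E) * ((p + 1) * w) ≤ w * y * (22 / 10) := by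
    have h1 : (1 + E) * (p + 1) ≤ 11 / 10 * 2 :=
      mul_le_mul (by linarith) (by linarith) (by linarith) (by norm_num)
    have := mul_le_mul_of_nonneg_left h1 (by positivity : 0 ≤ w * y)
    linarith
  have hfin : w * y * (32 / 10 - y * (w * s)) < 0 :=
    mul_neg_of_pos_of_neg (by positivity) (by linarith)
  linarith

theorem velocity_level_deriv_neg {p γ ε w s y h V K K₂ M : ℝ} (hp0 : 0 ≤ p)
    (hγ : 1 ≤ γ) (hε : 0 < ε) (hε1 : ε ≤ 1 / 10) (hw : 1 ≤ w) (hws : w ≤ s) (hV : 0 ≤ V)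
    (hhV : h ^ 2 ≤ V * y) (hy : y * w * s ≤ K₂) (hh : |h| * s ≤ K)
    (hK : 10 * (γ + 2) ^ 2 * K * ε ≤ 1) (hM0 : 0 < M) (hM : 2 * K₂ ≤ M)
    (hZ : V * (s / w) = M) :
    (-2 * V / w - 2 * h - 2 * ε * (γ + 1) * h * V) / ε * (s / w) + V * ((1 - p) / w) < 0 := by
  have hw0 : 0 < w := by linarith
  have hs0 : 0 < s := by linarith
  have hV0 : 0 < V := by
    rcases hV.eq_or_lt with h0 | h0
    · rw [← h0] at hZ; linarith
    · exact h0
  have hK0 : 0 ≤ K := le_trans (by positivity) hh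
  have hεK : 0 ≤ ε * K := by positivity
  have hwh : |w * h| ≤ K := by
    rw [abs_mul, abs_of_pos hw0]
    nlinarith [abs_nonneg h]
  have e2 : |ε * (γ + 1) * (w * h)| ≤ 1 / 10 := by
    rw [abs_mul, abs_of_nonneg (by positivity)]
    nlinarith [mul_le_mul_of_nonneg_left hwh (by positivity : 0 ≤ (γ + 1) * ε),
      mul_nonneg hεK (by linarith : 0 ≤ γ + 2)]
  obtain ⟨e2l, e2u⟩ := abs_le.1 e2
  have hyoung : -2 * (w * h) ≤ V / 2 + 2 * (w ^ 2 * y) := by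
    have h1 : (w * h) ^ 2 ≤ V * (w ^ 2 * y) := by
      rw [mul_pow]; nlinarith [mul_le_mul_of_nonneg_left hhV (sq_nonneg w)]
    have h2 : (-2 * (w * h)) ^ 2 ≤ (V / 2 + 2 * (w ^ 2 * y)) ^ 2 := by
      nlinarith [sq_nonneg (V / 2 - 2 * (w ^ 2 * y))]
    have hy0 : 0 ≤ y := by
      by_contra hcon
      nlinarith [sq_nonneg h]
    exact (abs_le_of_sq_le_sq' h2 (by positivity)).2
  have eq1 : (-2 * V / w - 2 * h - 2 * ε * (γ + 1) * h * V) / ε * (s / w) + V * ((1 - p) / w)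
      = s / (ε * w ^ 2) *
        (-2 * V - 2 * (w * h) - 2 * (ε * (γ + 1) * (w * h)) * V + ε * (1 - p) * V * (w / s)) := by
    field_simp
  rw [eq1]
  apply mul_neg_of_pos_of_neg (by positivity)
  have h3 : ε * (1 - p) * V * (w / s) ≤ 1 / 10 * V := by
    have hq : w / s ≤ 1 := (div_le_one hs0).2 hws
    have hq0 : 0 ≤ w / s := by positivity
    have : ε * (1 - p) * (w / s) ≤ 1 / 10 := by
      calc ε * (1 - p) * (w / s) ≤ ε * 1 * 1 := by gcongr; linarith
        _ ≤ _ := by linarith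
    nlinarith
  have h4 : w ^ 2 * y * 2 ≤ V := by
    have hVw : V * s = M * w := by rw [← hZ]; field_simp
    have : w ^ 2 * y * 2 * s ≤ V * s := by rw [hVw]; nlinarith
    exact le_of_mul_le_mul_right this hs0
  nlinarith

/-- Scalar quantities attached to a solution `x` of
`ε x'' + x' / w + g A x = 0`, `g = ⟨Ax,x⟩^γ`, `w = (1+t)^p`:
`a = ⟨Ax,x⟩`, `b = ⟨Ax,x'⟩`, `m = ⟨Ax',x'⟩`, `α = |Ax|²`, `β = |x'|²`, `k = ⟨Ax',Ax⟩`. -/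
structure HypScalars (p γ ε : ℝ) (w a b m α β k g : ℝ → ℝ) : Prop where
  w_deriv : ∀ t, 0 ≤ t → HasDerivWithinAt w (p * w t / (1 + t)) (Set.Ici 0) t
  one_le_w : ∀ t, 0 ≤ t → 1 ≤ w t
  w_le : ∀ t, 0 ≤ t → w t ≤ 1 + t
  a_deriv : ∀ t, 0 ≤ t → HasDerivWithinAt a (2 * b t) (Set.Ici 0) t
  b_deriv : ∀ t, 0 ≤ t →
    HasDerivWithinAt b (m t - (b t / w t + g t * α t) / ε) (Set.Ici 0) t
  m_deriv : ∀ t, 0 ≤ t → HasDerivWithinAt m (-2 * (m t / w t + g t * k t) / ε) (Set.Ici 0) t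
  α_deriv : ∀ t, 0 ≤ t → HasDerivWithinAt α (2 * k t) (Set.Ici 0) t
  β_deriv : ∀ t, 0 ≤ t → HasDerivWithinAt β (-2 * (β t / w t + g t * b t) / ε) (Set.Ici 0) t
  g_deriv : ∀ t, 0 ≤ t → 0 < a t →
    HasDerivWithinAt g (2 * γ * g t * b t / a t) (Set.Ici 0) t
  g_pos : ∀ t, 0 ≤ t → 0 < a t → 0 < g t
  α_nonneg : ∀ t, 0 ≤ t → 0 ≤ α t
  β_nonneg : ∀ t, 0 ≤ t → 0 ≤ β t
  b_sq_le_m : ∀ t, 0 ≤ t → b t ^ 2 ≤ m t * a t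
  b_sq_le_α : ∀ t, 0 ≤ t → b t ^ 2 ≤ α t * β t

namespace HypScalars

variable {p γ ε : ℝ} {w a b m α β k g : ℝ → ℝ}

theorem level_deriv (S : HypScalars p γ ε w a b m α β k g) (hε : 0 < ε) {t : ℝ} (ht : 0 ≤ t)
    (ha : 0 < a t) :
    HasDerivWithinAt (fun t => (ε * ((m t * a t - b t ^ 2) / a t ^ 2) + g t * α t / a t)
        * (1 + 2 * γ * ε * (w t * (b t / a t))) * (w t * (1 + t)))
      (((2 * γ * (b t / a t) * (ε * ((m t * a t - b t ^ 2) / a t ^ 2) + g t * α t / a t)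
          - 2 * ((m t * a t - b t ^ 2) / a t ^ 2) / w t
          - 2 * ε * (γ + 2) * (b t / a t) * ((m t * a t - b t ^ 2) / a t ^ 2))
          * (1 + 2 * γ * ε * (w t * (b t / a t)))
        + (ε * ((m t * a t - b t ^ 2) / a t ^ 2) + g t * α t / a t)
          * (2 * γ * ε * (p * w t / (1 + t) * (b t / a t) + w t *
            ((-(b t / a t) / w t - (ε * ((m t * a t - b t ^ 2) / a t ^ 2) + g t * α t / a t)
              + 2 * ε * ((m t * a t - b t ^ 2) / a t ^ 2) - ε * (b t / a t) ^ 2) / ε))))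
        * (w t * (1 + t))
        + (ε * ((m t * a t - b t ^ 2) / a t ^ 2) + g t * α t / a t)
          * (1 + 2 * γ * ε * (w t * (b t / a t))) * ((p + 1) * w t)) (Set.Ici 0) t := by
  have hw : 0 < w t := lt_of_lt_of_le one_pos (S.one_le_w t ht)
  have hs : 0 < 1 + t := by linarith
  have da := S.a_deriv t ht
  have db := S.b_deriv t ht
  have dw := S.w_deriv t ht
  have dn := (((S.m_deriv t ht).fun_mul da).fun_sub (db.fun_pow 2)).fun_div (da.fun_pow 2)
    (pow_pos ha 2).ne'
  have dq := ((S.g_deriv t ht ha).fun_mul (S.α_deriv t ht)).fun_div da ha.ne'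
  have dh := db.fun_div da ha.ne'
  have dy := (dn.const_mul ε).fun_add dq
  have dc := ((dw.fun_mul dh).const_mul (2 * γ * ε)).const_add 1
  have dws := dw.fun_mul ((hasDerivWithinAt_id t (Set.Ici 0)).const_add 1)
  have hh : (((m t - (b t / w t + g t * α t) / ε) * a t - b t * (2 * b t)) / a t ^ 2)
      = (-(b t / a t) / w t - (ε * ((m t * a t - b t ^ 2) / a t ^ 2) + g t * α t / a t)
              + 2 * ε * ((m t * a t - b t ^ 2) / a t ^ 2) - ε * (b t / a t) ^ 2) / ε := by
    field_simp; ring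
  have hy : (2 * γ * (b t / a t) * (ε * ((m t * a t - b t ^ 2) / a t ^ 2) + g t * α t / a t)
          - 2 * ((m t * a t - b t ^ 2) / a t ^ 2) / w t
          - 2 * ε * (γ + 2) * (b t / a t) * ((m t * a t - b t ^ 2) / a t ^ 2))
      = _ := (show _ = ε * ((((-2 * (m t / w t + g t * k t) / ε * a t + m t * (2 * b t))
          - (2 * b t * (m t - (b t / w t + g t * α t) / ε))) * a t ^ 2
          - (m t * a t - b t ^ 2) * (2 * a t * (2 * b t))) / (a t ^ 2) ^ 2)
          + ((2 * γ * g t * b t / a t * α t + g t * (2 * k t)) * a t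
            - g t * α t * (2 * b t)) / a t ^ 2 by field_simp; ring)
  have hws : p * w t / (1 + t) * (1 + t) + w t * 1 = (p + 1) * w t := by field_simp
  refine ((dy.fun_mul dc).fun_mul dws).congr_deriv ?_
  simp only [id, hws, hh, hy]
  norm_num

theorem velocity_level_deriv (S : HypScalars p γ ε w a b m α β k g) (hε : 0 < ε) {t : ℝ}
    (ht : 0 ≤ t) (ha : 0 < a t) :
    HasDerivWithinAt (fun t => β t / (a t * g t) * ((1 + t) / w t))
      ((-2 * (β t / (a t * g t)) / w t - 2 * (b t / a t)
        - 2 * ε * (γ + 1) * (b t / a t) * (β t / (a t * g t))) / ε * ((1 + t) / w t)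
        + β t / (a t * g t) * ((1 - p) / w t)) (Set.Ici 0) t := by
  have hw : 0 < w t := lt_of_lt_of_le one_pos (S.one_le_w t ht)
  have hs : 0 < 1 + t := by linarith
  have hg := S.g_pos t ht ha
  have dV := (S.β_deriv t ht).fun_div ((S.a_deriv t ht).fun_mul (S.g_deriv t ht ha))
    (mul_pos ha hg).ne'
  have ds := ((hasDerivWithinAt_id t (Set.Ici 0)).const_add 1).fun_div (S.w_deriv t ht) hw.ne'
  refine (dV.fun_mul ds).congr_deriv ?_
  simp only [id]
  field_simp
  ring

end HypScalars

theorem abs_correction_le {γ ε w s h K : ℝ} (hγ : 1 ≤ γ) (hε : 0 < ε) (hw : 1 ≤ w)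
    (hws : w ≤ s) (hh : |h| * s ≤ K) (hK : 10 * (γ + 2) ^ 2 * K * ε ≤ 1) :
    |2 * γ * ε * (w * h)| ≤ 1 / 10 := by
  have hwh : |w * h| ≤ K := by
    rw [abs_mul, abs_of_pos (by linarith)]
    nlinarith [abs_nonneg h]
  have hK0 : 0 ≤ K := (abs_nonneg _).trans hwh
  have h1 : 2 * γ ≤ (γ + 2) ^ 2 := by nlinarith
  rw [abs_mul, abs_of_nonneg (by positivity)]
  calc 2 * γ * ε * |w * h| ≤ (γ + 2) ^ 2 * ε * K := by gcongr
    _ ≤ 1 / 10 := by linarith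

namespace HypScalars

variable {p γ ε : ℝ} {w a b m α β k g : ℝ → ℝ}

theorem log_deriv_sq_le (S : HypScalars p γ ε w a b m α β k g) (hε : 0 < ε) {t : ℝ} (ht : 0 ≤ t)
    (ha : 0 < a t) :
    (b t / a t) ^ 2 ≤ β t / (a t * g t) *
      (ε * ((m t * a t - b t ^ 2) / a t ^ 2) + g t * α t / a t) := by
  have hg := S.g_pos t ht ha
  have hn : 0 ≤ (m t * a t - b t ^ 2) / a t ^ 2 :=
    div_nonneg (sub_nonneg.2 (S.b_sq_le_m t ht)) (sq_nonneg _)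
  have hV : 0 ≤ β t / (a t * g t) := div_nonneg (S.β_nonneg t ht) (mul_pos ha hg).le
  have h1 : (b t / a t) ^ 2 ≤ β t / (a t * g t) * (g t * α t / a t) := by
    rw [show β t / (a t * g t) * (g t * α t / a t) = α t * β t / a t ^ 2 by field_simp, div_pow]
    exact div_le_div_of_nonneg_right (S.b_sq_le_α t ht) (sq_nonneg _)
  refine h1.trans (mul_le_mul_of_nonneg_left ?_ hV)
  nlinarith

theorem abs_log_deriv_mul_le {h V y w s M N : ℝ} (hw : 0 < w) (hs : 0 < s) (hN : 0 ≤ N)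
    (hMN : M ≤ N) (hhV : h ^ 2 ≤ V * y) (hV0 : 0 ≤ V) (hV : V * (s / w) ≤ N)
    (hy : y * (w * s) ≤ M) : |h| * s ≤ N := by
  have h1 : (|h| * s) ^ 2 ≤ N ^ 2 := by
    rw [mul_pow, sq_abs]
    calc h ^ 2 * s ^ 2 ≤ V * y * s ^ 2 := by gcongr
      _ = V * (s / w) * (y * (w * s)) := by field_simp
      _ ≤ V * (s / w) * N := by
        have : 0 ≤ V * (s / w) := by positivity
        gcongr; linarith
      _ ≤ N * N := by gcongr
      _ = N ^ 2 := by ring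
  exact (abs_le_of_sq_le_sq' h1 hN).2

/-- A priori estimates: `a` stays positive, with the decay rates of the parabolic problem. -/
theorem apriori (S : HypScalars p γ ε w a b m α β k g) (hp0 : 0 ≤ p) (hp1 : p ≤ 1) (hγ : 1 ≤ γ)
    (hε : 0 < ε) (hε1 : ε ≤ 1 / 10) (hw0 : w 0 = 1) (ha0 : 0 < a 0) {M N : ℝ} (hM : 5 ≤ M)
    (hMN : 4 * M ≤ N)
    (hy0 : 11 / 10 * (ε * ((m 0 * a 0 - b 0 ^ 2) / a 0 ^ 2) + g 0 * α 0 / a 0) ≤ M)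
    (hV0 : β 0 / (a 0 * g 0) ≤ N) (hN : 20 * (γ + 2) ^ 2 * N * ε ≤ 1) :
    ∀ t, 0 ≤ t → 0 < a t ∧
      (ε * ((m t * a t - b t ^ 2) / a t ^ 2) + g t * α t / a t) * (w t * (1 + t)) ≤ 2 * M ∧
      β t / (a t * g t) * ((1 + t) / w t) ≤ 2 * N := by
  set y : ℝ → ℝ := fun t => ε * ((m t * a t - b t ^ 2) / a t ^ 2) + g t * α t / a t with hy
  set V : ℝ → ℝ := fun t => β t / (a t * g t) with hV
  have hN0 : 0 < N := by linarith
  have hwpos : ∀ t, 0 ≤ t → 0 < w t := fun t ht => lt_of_lt_of_le one_pos (S.one_le_w t ht)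
  have hVnn : ∀ t, 0 ≤ t → 0 < a t → 0 ≤ V t := fun t ht ha =>
    div_nonneg (S.β_nonneg t ht) (mul_pos ha (S.g_pos t ht ha)).le
  have hynn : ∀ t, 0 ≤ t → 0 < a t → 0 ≤ y t := fun t ht ha =>
    add_nonneg (mul_nonneg hε.le (div_nonneg (sub_nonneg.2 (S.b_sq_le_m t ht)) (sq_nonneg _)))
      (div_nonneg (mul_nonneg (S.g_pos t ht ha).le (S.α_nonneg t ht)) ha.le)
  suffices hstrict : ∀ t, 0 ≤ t → 0 < a t ∧ y t * (w t * (1 + t)) < 2 * M ∧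
      V t * ((1 + t) / w t) < 2 * N from
    fun t ht => ⟨(hstrict t ht).1, (hstrict t ht).2.1.le, (hstrict t ht).2.2.le⟩
  have hh : ∀ t, 0 ≤ t → 0 < a t → y t * (w t * (1 + t)) ≤ 2 * M → V t * ((1 + t) / w t) ≤ 2 * N →
      |b t / a t| * (1 + t) ≤ 2 * N := fun t ht ha h1 h2 =>
    abs_log_deriv_mul_le (hwpos t ht) (by linarith) (by linarith) (by linarith)
      (S.log_deriv_sq_le hε ht ha) (hVnn t ht ha) h2 h1
  have hK : 10 * (γ + 2) ^ 2 * (2 * N) * ε ≤ 1 := by linarith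
  have hcor : ∀ t, 0 ≤ t → |b t / a t| * (1 + t) ≤ 2 * N →
      |2 * γ * ε * (w t * (b t / a t))| ≤ 1 / 10 := fun t ht h =>
    abs_correction_le hγ hε (S.one_le_w t ht) (S.w_le t ht) h hK
  apply forall_nonneg_of_continuation
  · intro T hT hgood
    have hapos : ∀ t, 0 ≤ t → t ≤ T → 0 < a t := by
      intro t ht htT
      rcases htT.lt_or_eq with h | rfl
      · exact (hgood t ht h).1
      have hd : ∀ s, 0 ≤ s → HasDerivWithinAt (fun s => -(a s * Real.exp (4 * N * s)))
          (-(2 * b s * Real.exp (4 * N * s) + a s * (Real.exp (4 * N * s) * (4 * N * 1))))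
          (Set.Ici 0) s := fun s hs =>
        ((S.a_deriv s hs).fun_mul
          (((hasDerivWithinAt_id s (Set.Ici 0)).const_mul (4 * N)).exp)).fun_neg
      have hle := le_initial_of_deriv_nonpos ht
        (fun s hs => (hd s hs.1).continuousWithinAt.mono Set.Icc_subset_Ici_self)
        (fun s hs => hd s hs.1) (fun s hs => by
          obtain ⟨ha, h1, h2⟩ := hgood s hs.1 hs.2
          have h3 := hh s hs.1 ha h1.le h2.le
          have h4 : |b s / a s| ≤ 2 * N := by nlinarith [abs_nonneg (b s / a s), hs.1]
          have h5 : -(2 * N) * a s ≤ b s := by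
            rw [← le_div_iff₀ ha]; exact (abs_le.1 h4).1
          have h6 := Real.exp_pos (4 * N * s)
          have : 0 ≤ Real.exp (4 * N * s) * (2 * b s + 4 * N * a s) :=
            mul_nonneg h6.le (by linarith)
          linarith)
      simp only [mul_zero, Real.exp_zero, mul_one] at hle
      have h6 := Real.exp_pos (4 * N * t)
      by_contra hcon
      nlinarith
    have ha := hapos T hT le_rfl
    have hZ : y T * (1 + 2 * γ * ε * (w T * (b T / a T))) * (w T * (1 + T)) ≤ M := by
      refine le_of_deriv_neg_at_level
        (f := fun t => y t * (1 + 2 * γ * ε * (w t * (b t / a t))) * (w t * (1 + t))) hT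
        (fun s hs => (S.level_deriv hε hs.1 (hapos s hs.1 hs.2)).continuousWithinAt.mono
          Set.Icc_subset_Ici_self)
        (fun s hs => S.level_deriv hε hs.1 (hapos s hs.1 hs.2.le)) ?_ ?_
      · have h1 : y 0 ≤ M := by have := hynn 0 le_rfl ha0; linarith
        have h2 := hcor 0 le_rfl (hh 0 le_rfl ha0 (by rw [hw0]; linarith)
          (by rw [hw0]; linarith))
        have h3 := mul_le_mul_of_nonneg_left (by linarith [(abs_le.1 h2).2] :
          1 + 2 * γ * ε * (w 0 * (b 0 / a 0)) ≤ 11 / 10) (hynn 0 le_rfl ha0)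
        simp only [hw0] at h3 ⊢
        linarith
      · intro s hs hsM
        obtain ⟨ha, h1, h2⟩ := hgood s hs.1 hs.2
        have h3 := hh s hs.1 ha h1.le h2.le
        have hw := hwpos s hs.1
        refine level_deriv_neg_of_bounds (K := 2 * N) (M := M) hp0 hp1 hγ hε (S.one_le_w s hs.1)
          (S.w_le s hs.1) (div_nonneg (sub_nonneg.2 (S.b_sq_le_m s hs.1)) (sq_nonneg _))
          (hVnn s hs.1 ha) (S.log_deriv_sq_le hε hs.1 ha) ?_ ?_ h3 hK hM hsM
        · rw [mul_div_assoc', div_lt_iff₀ hw] at h2; exact h2.le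
        · rw [mul_assoc]; exact h1.le.trans (by linarith)
    have hVT : V T * ((1 + T) / w T) ≤ N := by
      refine le_of_deriv_neg_at_level (f := fun t => V t * ((1 + t) / w t)) hT
        (fun s hs => (S.velocity_level_deriv hε hs.1
          (hapos s hs.1 hs.2)).continuousWithinAt.mono Set.Icc_subset_Ici_self)
        (fun s hs => S.velocity_level_deriv hε hs.1 (hapos s hs.1 hs.2.le)) ?_ ?_
      · simp only [hw0]; linarith
      · intro s hs hsN
        obtain ⟨ha, h1, h2⟩ := hgood s hs.1 hs.2
        have h3 := hh s hs.1 ha h1.le h2.le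
        exact _root_.velocity_level_deriv_neg (K := 2 * N) (K₂ := 2 * M) (M := N) hp0 hγ hε hε1
          (S.one_le_w s hs.1) (S.w_le s hs.1) (hVnn s hs.1 ha) (S.log_deriv_sq_le hε hs.1 ha)
          (by rw [mul_assoc]; exact h1.le) h3 hK hN0 (by linarith) hsN
    have hhT : |b T / a T| * (1 + T) ≤ 2 * N := by
      rcases hT.eq_or_lt with rfl | hTpos
      · exact hh 0 le_rfl ha0 (by rw [hw0]; have := hynn 0 le_rfl ha0; linarith)
          (by rw [hw0]; linarith)
      · have hc : ContinuousWithinAt (fun t => |b t / a t| * (1 + t)) (Set.Ico 0 T) T :=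
          ((((S.b_deriv T hT).continuousWithinAt.div (S.a_deriv T hT).continuousWithinAt
            ha.ne').abs).mul (by fun_prop)).mono Set.Ico_subset_Ici_self
        refine ContinuousWithinAt.closure_le (by rw [closure_Ico hTpos.ne]; exact ⟨hT, le_rfl⟩) hc
          (continuousWithinAt_const (b := 2 * N)) fun s hs => ?_
        obtain ⟨ha, h1, h2⟩ := hgood s hs.1 hs.2
        exact hh s hs.1 ha h1.le h2.le
    refine ⟨ha, ?_, by linarith⟩
    have h2 := hcor T hT hhT
    have hyws : 0 ≤ y T * (w T * (1 + T)) :=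
      mul_nonneg (hynn T hT ha) (mul_nonneg (hwpos T hT).le (by linarith))
    have h3 := mul_le_mul_of_nonneg_left (by linarith [(abs_le.1 h2).1] :
      9 / 10 ≤ 1 + 2 * γ * ε * (w T * (b T / a T))) hyws
    linarith
  · intro T hT ⟨ha, h1, h2⟩
    have ca := (S.a_deriv T hT).continuousWithinAt
    have cw := (S.w_deriv T hT).continuousWithinAt
    have cg := (S.g_deriv T hT ha).continuousWithinAt
    have cy : ContinuousWithinAt y (Set.Ici 0) T :=
      (((((S.m_deriv T hT).continuousWithinAt.mul ca).sub
        ((S.b_deriv T hT).continuousWithinAt.pow 2)).div (ca.pow 2) (pow_pos ha 2).ne').const_mul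
          ε).add ((cg.mul (S.α_deriv T hT).continuousWithinAt).div ca ha.ne')
    have cyw : ContinuousWithinAt (fun t => y t * (w t * (1 + t))) (Set.Ici 0) T :=
      cy.mul (cw.mul (by fun_prop))
    filter_upwards [ca.eventually_const_lt ha, cyw.eventually_lt_const h1,
      (S.velocity_level_deriv hε hT ha).continuousWithinAt.eventually_lt_const h2]
      with s h1 h2 h3 using ⟨h1, h2, h3⟩

end HypScalars

namespace HypScalars

variable {p γ ε : ℝ} {w a b m α β k g : ℝ → ℝ}

theorem hamiltonian_deriv (S : HypScalars p γ ε w a b m α β k g) (hε : 0 < ε) {t : ℝ}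
    (ht : 0 ≤ t) (ha : 0 < a t) :
    HasDerivWithinAt (fun t => a t * g t + (γ + 1) * ε * β t) (-(2 * (γ + 1) * (β t / w t)))
      (Set.Ici 0) t := by
  have hw : 0 < w t := lt_of_lt_of_le one_pos (S.one_le_w t ht)
  refine (((S.a_deriv t ht).fun_mul (S.g_deriv t ht ha)).fun_add
    ((S.β_deriv t ht).const_mul ((γ + 1) * ε))).congr_deriv ?_
  field_simp
  ring

/-- Boundedness of `X = |x|²` and of `∫ w g a`, by means of a functional `J`. -/
theorem exists_energy (S : HypScalars p γ ε w a b m α β k g) (hp0 : 0 ≤ p) (hp1 : p ≤ 1)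
    (hγ : 1 ≤ γ) (hε : 0 < ε) (hε1 : ε ≤ 1 / 10) (hw0 : w 0 = 1) (ha : ∀ t, 0 ≤ t → 0 < a t)
    {K : ℝ} (hβ : ∀ t, 0 ≤ t → β t * (1 + t) ≤ K * w t * (a t * g t))
    (hK : 10 * (γ + 2) ^ 2 * K * ε ≤ 1) {X ξ : ℝ → ℝ}
    (hX : ∀ t, 0 ≤ t → HasDerivWithinAt X (2 * ξ t) (Set.Ici 0) t)
    (hξ : ∀ t, 0 ≤ t → HasDerivWithinAt ξ (β t - (ξ t / w t + g t * a t) / ε) (Set.Ici 0) t)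
    (hX0 : ∀ t, 0 ≤ t → 0 ≤ X t) (hξX : ∀ t, 0 ≤ t → ξ t ^ 2 ≤ X t * β t) :
    ∃ J J' : ℝ → ℝ, (∀ t, 0 ≤ t → HasDerivWithinAt J (J' t) (Set.Ici 0) t) ∧
      (∀ t, 0 ≤ t → J' t ≤ -(1 / 2 * (w t * (a t * g t)))) ∧
      (∀ t, 0 ≤ t → 1 / 4 * X t + 1 / 32 * (w t * (1 + t) * (a t * g t)) ≤ J t) ∧
      J 0 ≤ X 0 + 2 * |ξ 0| + a 0 * g 0 + (γ + 1) * β 0 := by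
  have hK0 : 0 ≤ K := by
    have h1 := hβ 0 le_rfl
    have h2 := mul_pos (ha 0 le_rfl) (S.g_pos 0 le_rfl (ha 0 le_rfl))
    have h3 := S.β_nonneg 0 le_rfl
    rw [hw0] at h1
    by_contra hcon
    nlinarith
  have hεK : 0 ≤ ε * K := by positivity
  have hεK1 : (γ + 1) * (ε * K) ≤ 1 / 10 := by nlinarith
  have hεK2 : ε * K ≤ 1 / 20 := by nlinarith
  have hlow : ∀ t, 0 ≤ t → 1 / 4 * X t + 1 / 32 * (w t * (1 + t) * (a t * g t)) ≤
      1 / 2 * X t - 1 / 2 * ε * p * (w t / (1 + t) * X t) + ε * (w t * ξ t)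
      + 1 / 16 * (w t * (1 + t) * (a t * g t + (γ + 1) * ε * β t)) := by
    intro t ht
    have hw := S.one_le_w t ht
    have hws := S.w_le t ht
    have hag := mul_pos (ha t ht) (S.g_pos t ht (ha t ht))
    have hβ0 := S.β_nonneg t ht
    have hX0 := hX0 t ht
    have h1 : ε * p * (w t / (1 + t) * X t) ≤ 1 / 10 * X t := by
      have hq : w t / (1 + t) ≤ 1 := (div_le_one (by linarith)).2 hws
      calc ε * p * (w t / (1 + t) * X t) ≤ 1 / 10 * 1 * (1 * X t) := by gcongr
        _ = _ := by ring
    have h2 : (ε * (w t * ξ t)) ^ 2 ≤ (1 / 16 * X t + 4 * ε ^ 2 * w t ^ 2 * β t) ^ 2 := by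
      have : (ε * (w t * ξ t)) ^ 2 ≤ (ε * w t) ^ 2 * (X t * β t) := by
        rw [show (ε * (w t * ξ t)) ^ 2 = (ε * w t) ^ 2 * ξ t ^ 2 by ring]
        gcongr
        exact hξX t ht
      nlinarith [sq_nonneg (1 / 16 * X t - 4 * ε ^ 2 * w t ^ 2 * β t)]
    have h3 := (abs_le_of_sq_le_sq' h2 (by positivity)).1
    have h4 : 4 * ε ^ 2 * w t ^ 2 * β t ≤ 1 / 32 * (w t * (1 + t) * (a t * g t)) := by
      have h5 : w t * β t ≤ K * w t * (a t * g t) :=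
        (by nlinarith : w t * β t ≤ β t * (1 + t)).trans (hβ t ht)
      calc 4 * ε ^ 2 * w t ^ 2 * β t = 4 * ε ^ 2 * w t * (w t * β t) := by ring
        _ ≤ 4 * ε ^ 2 * w t * (K * w t * (a t * g t)) := by gcongr
        _ = 4 * ε * (ε * K) * (w t * w t * (a t * g t)) := by ring
        _ ≤ 4 * (1 / 10) * (1 / 20) * (w t * (1 + t) * (a t * g t)) := by gcongr
        _ ≤ _ := by
          have : 0 < w t * (1 + t) * (a t * g t) := by positivity
          linarith
    have h6 : 0 ≤ w t * (1 + t) * ((γ + 1) * ε * β t) := by positivity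
    linarith
  have hd : ∀ t, 0 ≤ t → HasDerivWithinAt (fun t => (1 + w t / (1 + t)) *
      (1 / 2 * X t - 1 / 2 * ε * p * (w t / (1 + t) * X t) + ε * (w t * ξ t)
      + 1 / 16 * (w t * (1 + t) * (a t * g t + (γ + 1) * ε * β t))))
      (-((1 - p) * (w t / (1 + t)) / (1 + t)) *
        (1 / 2 * X t - 1 / 2 * ε * p * (w t / (1 + t) * X t) + ε * (w t * ξ t)
        + 1 / 16 * (w t * (1 + t) * (a t * g t + (γ + 1) * ε * β t)))
      + (1 + w t / (1 + t)) * (1 / 2 * ε * p * (1 - p) * (w t / (1 + t)) / (1 + t) * X t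
        + ε * w t * β t - w t * (a t * g t)
        + 1 / 16 * ((p + 1) * w t * (a t * g t + (γ + 1) * ε * β t)
          - 2 * (γ + 1) * (1 + t) * β t))) (Set.Ici 0) t := by
    intro t ht
    have hw : 0 < w t := lt_of_lt_of_le one_pos (S.one_le_w t ht)
    have hs : 0 < 1 + t := by linarith
    have dw := S.w_deriv t ht
    have ds := (hasDerivWithinAt_id t (Set.Ici 0)).const_add 1
    have dq := dw.fun_div ds hs.ne'
    refine ((dq.const_add 1).fun_mul (((((hX t ht).const_mul (1 / 2)).fun_sub
      ((dq.fun_mul (hX t ht)).const_mul (1 / 2 * ε * p))).fun_add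
      ((dw.fun_mul (hξ t ht)).const_mul ε)).fun_add (((dw.fun_mul ds).fun_mul
        (S.hamiltonian_deriv hε ht (ha t ht))).const_mul (1 / 16)))).congr_deriv ?_
    simp only [id]
    field_simp
    ring
  refine ⟨_, _, hd, fun t ht => ?_, fun t ht => ?_, ?_⟩
  · have hw := S.one_le_w t ht
    have hws := S.w_le t ht
    have hs : 0 < 1 + t := by linarith
    have hag := mul_pos (ha t ht) (S.g_pos t ht (ha t ht))
    have hβ0 := S.β_nonneg t ht
    have hX0 := hX0 t ht
    have hlow := hlow t ht
    have hβ := hβ t ht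
    set D := 1 / 2 * X t - 1 / 2 * ε * p * (w t / (1 + t) * X t) + ε * (w t * ξ t)
        + 1 / 16 * (w t * (1 + t) * (a t * g t + (γ + 1) * ε * β t))
    set q := w t / (1 + t) with hq
    have hq1 : q ≤ 1 := (div_le_one hs).2 hws
    have hq0 : 0 ≤ q := by positivity
    have hXD : X t ≤ 4 * D := by
      have : 0 < w t * (1 + t) * (a t * g t) := by positivity
      linarith
    have hβq : β t ≤ K * (a t * g t) := by
      have : β t = β t * (1 + t) / (1 + t) := by field_simp
      rw [this, div_le_iff₀ hs]
      calc β t * (1 + t) ≤ K * w t * (a t * g t) := hβ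
        _ ≤ K * (1 + t) * (a t * g t) := by gcongr
        _ = _ := by ring
    have h1 : ε * w t * β t ≤ 1 / 10 * (w t * (a t * g t)) := by
      calc ε * w t * β t ≤ ε * w t * (K * (a t * g t)) := by gcongr
        _ = (ε * K) * (w t * (a t * g t)) := by ring
        _ ≤ _ := by gcongr; linarith
    have h2 : (p + 1) * w t * (a t * g t + (γ + 1) * ε * β t) ≤ 4 * (w t * (a t * g t)) := by
      have : (γ + 1) * ε * β t ≤ 1 * (a t * g t) := by
        calc (γ + 1) * ε * β t ≤ (γ + 1) * ε * (K * (a t * g t)) := by gcongr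
          _ = (γ + 1) * (ε * K) * (a t * g t) := by ring
          _ ≤ 1 * (a t * g t) := by gcongr; linarith
      calc (p + 1) * w t * (a t * g t + (γ + 1) * ε * β t)
          ≤ (1 + 1) * w t * (a t * g t + 1 * (a t * g t)) := by gcongr
        _ = _ := by ring
    have h3 : 0 ≤ 2 * (γ + 1) * (1 + t) * β t := by positivity
    have h4 : 1 / 2 * ε * p * (1 - p) * q / (1 + t) * X t ≤
        1 / 2 * ((1 - p) * q / (1 + t) * D) := by
      have h5 : 0 ≤ (1 - p) * q / (1 + t) :=
        div_nonneg (mul_nonneg (by linarith) hq0) hs.le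
      have h6 : ε * p * X t ≤ D := by
        calc ε * p * X t ≤ 1 / 10 * 1 * X t := by gcongr
          _ ≤ D := by linarith
      calc 1 / 2 * ε * p * (1 - p) * q / (1 + t) * X t
          = 1 / 2 * ((1 - p) * q / (1 + t) * (ε * p * X t)) := by ring
        _ ≤ _ := by gcongr
    have h7 : 0 ≤ w t * (a t * g t) := by positivity
    have h8 : 0 ≤ (1 - p) * q / (1 + t) * D :=
      mul_nonneg (div_nonneg (mul_nonneg (by linarith) hq0) hs.le) (by linarith)
    calc _ ≤ -((1 - p) * q / (1 + t) * D) + (1 + q) * (1 / 2 * ((1 - p) * q / (1 + t) * D)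
            - 1 / 2 * (w t * (a t * g t))) := by
          rw [neg_mul]
          gcongr
          linarith
      _ ≤ _ := by nlinarith
  · have := hlow t ht
    have hw := S.one_le_w t ht
    have hX0 := hX0 t ht
    have hag := mul_pos (ha t ht) (S.g_pos t ht (ha t ht))
    refine this.trans (le_mul_of_one_le_left (le_trans (by positivity) this) ?_)
    have : 0 ≤ w t / (1 + t) := by positivity
    linarith
  · have hag := mul_pos (ha 0 le_rfl) (S.g_pos 0 le_rfl (ha 0 le_rfl))
    have hβ0 := S.β_nonneg 0 le_rfl
    have hX0 := hX0 0 le_rfl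
    have h1 : 0 ≤ ε * p * X 0 := by positivity
    have h2 : ε * ξ 0 ≤ 1 * |ξ 0| := by
      calc ε * ξ 0 ≤ ε * |ξ 0| := by gcongr; exact le_abs_self _
        _ ≤ 1 * |ξ 0| := by gcongr; linarith
    have h3 : (γ + 1) * ε * β 0 ≤ (γ + 1) * 1 * β 0 := by gcongr; linarith
    have h4 : 0 ≤ (γ + 1) * β 0 := by positivity
    simp only [hw0, add_zero]
    linarith

end HypScalars

section Solutions

variable {H : Type*} [NormedAddCommGroup H] [InnerProductSpace ℝ H] {A : H →L[ℝ] H}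

theorem HasDerivWithinAt.clm_map {f : ℝ → H} {f' : H} {s : Set ℝ} {t : ℝ}
    (hf : HasDerivWithinAt f f' s t) :
    HasDerivWithinAt (fun t => A (f t)) (A f') s t :=
  A.hasFDerivAt.comp_hasDerivWithinAt t hf

theorem HasDerivWithinAt.inner_map_self (hsa : ∀ x y : H, ⟪A x, y⟫ = ⟪x, A y⟫) {f : ℝ → H}
    {f' : H} {s : Set ℝ} {t : ℝ} (hf : HasDerivWithinAt f f' s t) :
    HasDerivWithinAt (fun t => ⟪A (f t), f t⟫) (2 * ⟪A (f t), f'⟫) s t := by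
  refine (hf.clm_map.inner ℝ hf).congr_deriv ?_
  rw [hsa f', real_inner_comm f']
  ring

theorem HasDerivWithinAt.norm_sq' {f : ℝ → H}
    {f' : H} {s : Set ℝ} {t : ℝ} (hf : HasDerivWithinAt f f' s t) :
    HasDerivWithinAt (fun t => ‖f t‖ ^ 2) (2 * ⟪f', f t⟫) s t := by
  refine hf.norm_sq.congr_deriv ?_
  rw [real_inner_comm]

variable {p γ ε : ℝ} {u₀ u₁ : H} {x x' x'' : ℝ → H}

theorem IsHypSolution.acceleration_eq (hx : IsHypSolution A p γ ε u₀ u₁ x x' x'') (hε : 0 < ε)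
    {t : ℝ} (ht : 0 ≤ t) :
    x'' t = -(1 / ε) • (((1 + t) ^ p)⁻¹ • x' t + (⟪A (x t), x t⟫ ^ γ) • A (x t)) := by
  have h := hx.2.2.2.2.2 t ht
  rw [Real.rpow_neg (by linarith), add_assoc] at h
  rw [neg_smul, ← smul_neg, ← eq_neg_of_add_eq_zero_left h, smul_smul, one_div,
    inv_mul_cancel₀ hε.ne', one_smul]

theorem IsHypSolution.inner_acceleration (hx : IsHypSolution A p γ ε u₀ u₁ x x' x'')
    (hε : 0 < ε) {t : ℝ} (ht : 0 ≤ t) (z : H) :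
    ⟪x'' t, z⟫ = -(⟪x' t, z⟫ / (1 + t) ^ p + ⟪A (x t), x t⟫ ^ γ * ⟪A (x t), z⟫) / ε := by
  rw [hx.acceleration_eq hε ht]
  simp only [real_inner_smul_left, inner_add_left]
  ring

theorem IsHypSolution.hypScalars (hx : IsHypSolution A p γ ε u₀ u₁ x x' x'')
    (hsa : ∀ x y : H, ⟪A x, y⟫ = ⟪x, A y⟫) (hnn : ∀ x : H, 0 ≤ ⟪A x, x⟫)
    (hp0 : 0 ≤ p) (hp1 : p ≤ 1) (hε : 0 < ε) :
    HypScalars p γ ε (fun t => (1 + t) ^ p) (fun t => ⟪A (x t), x t⟫) (fun t => ⟪A (x t), x' t⟫)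
      (fun t => ⟪A (x' t), x' t⟫) (fun t => ‖A (x t)‖ ^ 2) (fun t => ‖x' t‖ ^ 2)
      (fun t => ⟪A (x' t), A (x t)⟫) (fun t => ⟪A (x t), x t⟫ ^ γ) where
  w_deriv t ht := hasDerivWithinAt_one_add_rpow p ht
  one_le_w t ht := one_le_one_add_rpow hp0 ht
  w_le t ht := one_add_rpow_le hp1 ht
  a_deriv t ht := (hx.2.2.1 t ht).inner_map_self hsa
  b_deriv t ht := by
    refine ((hx.2.2.1 t ht).clm_map.inner ℝ (hx.2.2.2.1 t ht)).congr_deriv ?_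
    rw [real_inner_comm (x'' t), hx.inner_acceleration hε ht, real_inner_comm (A (x t)) (x' t),
      real_inner_self_eq_norm_sq]
    ring
  m_deriv t ht := by
    refine ((hx.2.2.2.1 t ht).inner_map_self hsa).congr_deriv ?_
    rw [real_inner_comm (x'' t), hx.inner_acceleration hε ht, real_inner_comm (A (x' t)) (x' t),
      real_inner_comm (A (x' t)) (A (x t))]
    ring
  α_deriv t ht := (hx.2.2.1 t ht).clm_map.norm_sq'
  β_deriv t ht := by
    refine (hx.2.2.2.1 t ht).norm_sq'.congr_deriv ?_
    rw [hx.inner_acceleration hε ht, real_inner_self_eq_norm_sq]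
    ring
  g_deriv t ht ha := by
    refine (((hx.2.2.1 t ht).inner_map_self hsa).rpow_const (p := γ) (Or.inl ha.ne')).congr_deriv ?_
    rw [Real.rpow_sub_one ha.ne']
    ring
  g_pos t ht ha := Real.rpow_pos_of_pos ha γ
  α_nonneg t ht := sq_nonneg _
  β_nonneg t ht := sq_nonneg _
  b_sq_le_m t ht := (inner_map_sq_le hsa hnn _ _).trans_eq (mul_comm _ _)
  b_sq_le_α t ht := by
    rw [← mul_pow]
    exact sq_le_sq' (neg_le_of_abs_le (abs_real_inner_le_norm _ _)) (real_inner_le_norm _ _)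

/-- Estimates for hyperbolic solutions, uniform in small `ε`. -/
theorem exists_hyp_estimates (hsa : ∀ x y : H, ⟪A x, y⟫ = ⟪x, A y⟫) (hnn : ∀ x : H, 0 ≤ ⟪A x, x⟫)
    (hp0 : 0 ≤ p) (hp1 : p ≤ 1) (hγ : 1 ≤ γ) (u₀ u₁ : H) (hmdg : 0 < ⟪A u₀, u₀⟫) :
    ∃ ε₀ > 0, ∃ C > 0, ∀ ε, 0 < ε → ε < ε₀ → ∀ x x' x'' : ℝ → H,
      IsHypSolution A p γ ε u₀ u₁ x x' x'' →
      (∀ t, 0 ≤ t → 0 < ⟪A (x t), x t⟫ ∧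
        ⟪A (x t), x t⟫ ^ γ * ‖A (x t)‖ ^ 2 * ((1 + t) ^ p * (1 + t)) ≤ C * ⟪A (x t), x t⟫ ∧
        ‖x' t‖ ^ 2 * (1 + t) ≤ C * (1 + t) ^ p * (⟪A (x t), x t⟫ * ⟪A (x t), x t⟫ ^ γ) ∧
        ‖x t‖ ^ 2 ≤ C ∧ (1 + t) ^ p * (1 + t) * (⟪A (x t), x t⟫ * ⟪A (x t), x t⟫ ^ γ) ≤ C) ∧
      ∃ J J' : ℝ → ℝ, (∀ t, 0 ≤ t → HasDerivWithinAt J (J' t) (Set.Ici 0) t) ∧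
        (∀ t, 0 ≤ t → J' t ≤ -(1 / 2 * ((1 + t) ^ p * (⟪A (x t), x t⟫ * ⟪A (x t), x t⟫ ^ γ)))) ∧
        (∀ t, 0 ≤ t → 0 ≤ J t) ∧ J 0 ≤ C := by
  set a₀ := ⟪A u₀, u₀⟫ with ha₀
  set g₀ := a₀ ^ γ with hg₀
  have hg₀pos : 0 < g₀ := Real.rpow_pos_of_pos hmdg γ
  set n₀ := (⟪A u₁, u₁⟫ * a₀ - ⟪A u₀, u₁⟫ ^ 2) / a₀ ^ 2 with hn₀
  have hn₀nn : 0 ≤ n₀ := div_nonneg (sub_nonneg.2 ((inner_map_sq_le hsa hnn _ _).trans_eq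
    (mul_comm _ _))) (sq_nonneg _)
  set M := 5 + 2 * (n₀ + g₀ * ‖A u₀‖ ^ 2 / a₀) with hM
  have hαnn : 0 ≤ g₀ * ‖A u₀‖ ^ 2 / a₀ := by positivity
  set N := 4 * M + ‖u₁‖ ^ 2 / (a₀ * g₀) with hN
  have hVnn : 0 ≤ ‖u₁‖ ^ 2 / (a₀ * g₀) := by positivity
  have hNpos : 0 < N := by linarith
  set C₀ := ‖u₀‖ ^ 2 + 2 * |⟪u₁, u₀⟫| + a₀ * g₀ + (γ + 1) * ‖u₁‖ ^ 2 with hC₀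
  have hC₀nn : 0 ≤ C₀ := by positivity
  refine ⟨min (1 / 10) (1 / (20 * (γ + 2) ^ 2 * N)), by positivity, 2 * M + 2 * N + 32 * C₀,
    by linarith, fun ε hε hεε x x' x'' hx => ?_⟩
  have hε1 : ε ≤ 1 / 10 := (lt_of_lt_of_le hεε (min_le_left _ _)).le
  have hεN : 20 * (γ + 2) ^ 2 * N * ε ≤ 1 := by
    have := (lt_of_lt_of_le hεε (min_le_right _ _)).le
    rw [le_div_iff₀ (by positivity)] at this
    linarith
  have S := hx.hypScalars hsa hnn hp0 hp1 hε
  have acc := fun t (ht : 0 ≤ t) z => hx.inner_acceleration hε ht z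
  obtain ⟨h0, h0', hdx, hdx', -, -⟩ := hx
  have est := S.apriori hp0 hp1 hγ hε hε1 (by simp) (by simpa only [h0] using hmdg)
    (M := M) (N := N) (by linarith) (by linarith)
    (by
      simp only [h0, h0']
      have : ε * n₀ ≤ 1 * n₀ := by gcongr; linarith
      rw [← ha₀, ← hg₀, ← hn₀]
      linarith)
    (by simp only [h0, h0']; rw [← ha₀, ← hg₀]; linarith) hεN
  have hvel : ∀ t, 0 ≤ t → ‖x' t‖ ^ 2 * (1 + t)
      ≤ 2 * N * (1 + t) ^ p * (⟪A (x t), x t⟫ * ⟪A (x t), x t⟫ ^ γ) := by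
    intro t ht
    obtain ⟨ha, -, hV⟩ := est t ht
    have hw : (0 : ℝ) < (1 + t) ^ p := Real.rpow_pos_of_pos (by linarith) p
    have hag := mul_pos ha (Real.rpow_pos_of_pos ha γ)
    rw [div_mul_div_comm, div_le_iff₀ (mul_pos hag hw)] at hV
    linarith
  obtain ⟨J, J', hJd, hJ', hJlow, hJ0⟩ := S.exists_energy hp0 hp1 hγ hε hε1 (by simp)
    (fun t ht => (est t ht).1) hvel (by linarith)
    (X := fun t => ‖x t‖ ^ 2) (ξ := fun t => ⟪x' t, x t⟫)
    (fun t ht => (hdx t ht).norm_sq')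
    (fun t ht => by
      refine ((hdx' t ht).inner ℝ (hdx t ht)).congr_deriv ?_
      rw [real_inner_self_eq_norm_sq, acc t ht]
      ring)
    (fun t ht => sq_nonneg _)
    (fun t ht => by
      rw [← mul_pow, mul_comm ‖x t‖]
      exact sq_le_sq' (neg_le_of_abs_le (abs_real_inner_le_norm _ _)) (real_inner_le_norm _ _))
  have hagpos : ∀ t, 0 ≤ t → 0 < (1 + t) ^ p * (⟪A (x t), x t⟫ * ⟪A (x t), x t⟫ ^ γ) :=
    fun t ht => mul_pos (Real.rpow_pos_of_pos (by linarith) p)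
      (mul_pos (est t ht).1 (Real.rpow_pos_of_pos (est t ht).1 γ))
  have hJ0' : J 0 ≤ C₀ := by simpa only [h0, h0'] using hJ0
  have hJle : ∀ t, 0 ≤ t → J t ≤ C₀ := fun t ht =>
    (le_initial_of_deriv_nonpos_Ici hJd
      (fun s hs => (hJ' s hs).trans (by linarith [hagpos s hs])) ht).trans hJ0'
  refine ⟨fun t ht => ⟨(est t ht).1, ?_, ?_, ?_, ?_⟩, J, J', hJd, hJ', fun t ht => ?_, by linarith⟩
  · obtain ⟨ha, hy, -⟩ := est t ht
    have hws : 0 < (1 + t) ^ p * (1 + t) :=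
      mul_pos (Real.rpow_pos_of_pos (by linarith) p) (by linarith)
    have hn : 0 ≤ ε * ((⟪A (x' t), x' t⟫ * ⟪A (x t), x t⟫ - ⟪A (x t), x' t⟫ ^ 2)
        / ⟪A (x t), x t⟫ ^ 2) :=
      mul_nonneg hε.le (div_nonneg (sub_nonneg.2 (S.b_sq_le_m t ht)) (sq_nonneg _))
    have h1 : ⟪A (x t), x t⟫ ^ γ * ‖A (x t)‖ ^ 2 / ⟪A (x t), x t⟫ * ((1 + t) ^ p * (1 + t))
        ≤ 2 * M := by
      refine le_trans ?_ hy
      gcongr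
      linarith
    rw [div_mul_eq_mul_div, div_le_iff₀ ha] at h1
    refine h1.trans ?_
    gcongr
    linarith
  · refine (hvel t ht).trans ?_
    have := mul_le_mul_of_nonneg_right
      (by linarith : 2 * N ≤ 2 * M + 2 * N + 32 * C₀) (hagpos t ht).le
    linarith
  · have h1 := hJlow t ht
    have h2 := hJle t ht
    have h3 : 0 ≤ (1 + t) ^ p * (1 + t) * (⟪A (x t), x t⟫ * ⟪A (x t), x t⟫ ^ γ) := by
      have := mul_nonneg (hagpos t ht).le (by linarith : 0 ≤ 1 + t)
      linarith
    linarith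
  · have h1 := hJlow t ht
    have h2 := hJle t ht
    have h3 := sq_nonneg ‖x t‖
    linarith
  · refine le_trans ?_ (hJlow t ht)
    have := mul_nonneg (hagpos t ht).le (by linarith : 0 ≤ 1 + t)
    have h3 := sq_nonneg ‖x t‖
    linarith

end Solutions

/-- The scalar quantities attached to a parabolic solution `u`: `w = (1 + t) ^ p`,
`a = ⟪A u, u⟫`, `g = a ^ γ`, `α = ‖A u‖ ^ 2`, `σ = ⟪A (A u), A u⟫`, `τ = ‖A (A u)‖ ^ 2`. -/
structure ParScalars (p γ L : ℝ) (w a g α σ τ : ℝ → ℝ) : Prop where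
  w_deriv : ∀ t, 0 ≤ t → HasDerivWithinAt w (p * w t / (1 + t)) (Set.Ici 0) t
  one_le_w : ∀ t, 0 ≤ t → 1 ≤ w t
  w_le : ∀ t, 0 ≤ t → w t ≤ 1 + t
  a_deriv : ∀ t, 0 ≤ t → HasDerivWithinAt a (-2 * (w t * g t * α t)) (Set.Ici 0) t
  α_deriv : ∀ t, 0 ≤ t → HasDerivWithinAt α (-2 * (w t * g t * σ t)) (Set.Ici 0) t
  σ_deriv : ∀ t, 0 ≤ t → HasDerivWithinAt σ (-2 * (w t * g t * τ t)) (Set.Ici 0) t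
  g_deriv : ∀ t, 0 ≤ t → 0 < a t →
    HasDerivWithinAt g (γ * (g t / a t) * (-2 * (w t * g t * α t))) (Set.Ici 0) t
  a_nonneg : ∀ t, 0 ≤ t → 0 ≤ a t
  g_nonneg : ∀ t, 0 ≤ t → 0 ≤ g t
  g_pos : ∀ t, 0 ≤ t → 0 < a t → 0 < g t
  g_mono : ∀ t, 0 ≤ t → a t ≤ a 0 → g t ≤ g 0
  α_nonneg : ∀ t, 0 ≤ t → 0 ≤ α t
  σ_nonneg : ∀ t, 0 ≤ t → 0 ≤ σ t
  τ_nonneg : ∀ t, 0 ≤ t → 0 ≤ τ t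
  α_le : ∀ t, 0 ≤ t → α t ≤ L * a t
  α_sq_le : ∀ t, 0 ≤ t → α t ^ 2 ≤ a t * σ t

namespace ParScalars

variable {p γ L : ℝ} {w a g α σ τ : ℝ → ℝ}

theorem a_le (S : ParScalars p γ L w a g α σ τ) {t : ℝ} (ht : 0 ≤ t) : a t ≤ a 0 :=
  le_initial_of_deriv_nonpos_Ici S.a_deriv (fun s hs => by
    have := mul_nonneg (mul_nonneg (zero_le_one.trans (S.one_le_w s hs)) (S.g_nonneg s hs))
      (S.α_nonneg s hs)
    linarith) ht

theorem a_pos (S : ParScalars p γ L w a g α σ τ) (h0 : 0 < a 0) {t : ℝ}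
    (ht : 0 ≤ t) : 0 < a t := by
  set k := 2 * L * g 0
  have hφ : ∀ s, 0 ≤ s → HasDerivWithinAt (fun s => -(a s * exp (k * (s + s ^ 2 / 2))))
      (-(-2 * (w s * g s * α s) * exp (k * (s + s ^ 2 / 2))
        + a s * (exp (k * (s + s ^ 2 / 2)) * (k * (1 + s))))) (Set.Ici 0) s := fun s hs => by
    have h1 : HasDerivAt (fun s : ℝ => k * (s + s ^ 2 / 2)) (k * (1 + s)) s := by
      refine (((hasDerivAt_id s).add (((hasDerivAt_id s).pow 2).div_const 2)).const_mul k
        ).congr_deriv ?_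
      simp
    exact ((S.a_deriv s hs).mul h1.exp.hasDerivWithinAt).neg
  have := le_initial_of_deriv_nonpos_Ici hφ (fun s hs => by
    have h1 : w s * g s * α s ≤ (1 + s) * g 0 * (L * a s) := by
      have := S.g_nonneg 0 le_rfl
      have := S.g_mono s hs (S.a_le hs)
      have := S.w_le s hs
      have := S.α_le s hs
      have := S.g_nonneg s hs
      have := S.α_nonneg s hs
      have := S.a_nonneg s hs
      gcongr
    have h2 := mul_le_mul_of_nonneg_right h1 (exp_pos (k * (s + s ^ 2 / 2))).le
    simp only [k] at h2 ⊢
    linarith) ht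
  have he := exp_pos (k * (t + t ^ 2 / 2))
  norm_num at this
  by_contra hcon
  nlinarith

theorem exists_estimates (S : ParScalars p γ L w a g α σ τ) (hp0 : 0 ≤ p) (hp1 : p ≤ 1)
    (hγ : 1 ≤ γ) (hL : 0 ≤ L) (h0 : 0 < a 0) :
    ∃ K > 0, (∀ t, 0 ≤ t → g t * α t * (w t * (1 + t)) ≤ K * a t ∧
        1 ≤ K * (w t * (1 + t)) * g t) ∧
      ∃ Θ Θ' : ℝ → ℝ, (∀ t, 0 ≤ t → HasDerivWithinAt Θ (Θ' t) (Set.Ici 0) t) ∧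
        (∀ t, 0 ≤ t → Θ' t ≤ -(2 * w t ^ 5 * g t ^ 3 * τ t
          + 2 * (1 + 2 * γ * K) ^ 2 * (w t * g t * α t))) ∧
        ∀ t, 0 ≤ t → 0 ≤ Θ t := by
  have ha : ∀ t, 0 ≤ t → 0 < a t := fun t ht => S.a_pos h0 ht
  have hg : ∀ t, 0 ≤ t → 0 < g t := fun t ht => S.g_pos t ht (ha t ht)
  have hw : ∀ t, 0 ≤ t → 0 < w t := fun t ht => zero_lt_one.trans_le (S.one_le_w t ht)
  have hs : ∀ t : ℝ, 0 ≤ t → HasDerivWithinAt (fun t : ℝ => 1 + t) 1 (Set.Ici 0) t :=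
    fun t _ => ((hasDerivAt_id t).const_add 1).hasDerivWithinAt
  have hws : ∀ t, 0 ≤ t → HasDerivWithinAt (fun t => w t * (1 + t)) ((p + 1) * w t)
      (Set.Ici 0) t := fun t ht => by
    have h1t : 1 + t ≠ 0 := by linarith
    refine ((S.w_deriv t ht).mul (hs t ht)).congr_deriv ?_
    field_simp
  have hw0 : 1 ≤ w 0 := S.one_le_w 0 le_rfl
  have hY0 : 0 ≤ g 0 * α 0 / a 0 * (w 0 * (1 + 0)) :=
    mul_nonneg (div_nonneg (mul_nonneg (hg 0 le_rfl).le (S.α_nonneg 0 le_rfl)) h0.le)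
      (by linarith)
  set M := g 0 * α 0 / a 0 * (w 0 * (1 + 0)) + 2 with hM
  have hydec : ∀ t, 0 ≤ t → g t * α t / a t * (w t * (1 + t)) ≤ M := fun T hT => by
    have hd : ∀ t, 0 ≤ t → HasDerivWithinAt (fun t => g t * α t / a t * (w t * (1 + t)))
        _ (Set.Ici 0) t := fun t ht =>
      (((S.g_deriv t ht (ha t ht)).fun_mul (S.α_deriv t ht)).fun_div (S.a_deriv t ht)
        (ha t ht).ne').fun_mul (hws t ht)
    refine le_of_deriv_neg_at_level (f := fun t => g t * α t / a t * (w t * (1 + t))) hT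
      (fun t ht => (hd t ht.1).continuousWithinAt.mono Set.Icc_subset_Ici_self)
      (fun t ht => hd t ht.1) (by linarith) fun t ht hYM => ?_
    have hat := ha t ht.1
    have hwt := hw t ht.1
    have hst : 0 < 1 + t := by linarith [ht.1]
    have hwst := mul_pos hwt hst
    have hy : 0 < g t * α t / a t := by
      refine pos_of_mul_pos_left (b := w t * (1 + t)) ?_ hwst.le
      rw [hYM]; linarith
    have hcs : 0 ≤ g t ^ 2 / a t ^ 2 * (a t * σ t - α t ^ 2) :=
      mul_nonneg (by positivity) (sub_nonneg.2 (S.α_sq_le t ht.1))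
    have hmain : (γ * (g t / a t) * (-2 * (w t * g t * α t)) * α t
        + g t * (-2 * (w t * g t * σ t))) * a t - g t * α t * (-2 * (w t * g t * α t))
        = a t ^ 2 * (-(2 * γ * w t * (g t * α t / a t) ^ 2)
          - 2 * w t * (g t ^ 2 / a t ^ 2 * (a t * σ t - α t ^ 2))) := by
      field_simp
      ring
    rw [hmain, mul_div_cancel_left₀ _ (by positivity)]
    have e1 : γ * w t * (g t * α t / a t) ^ 2 * (w t * (1 + t))
        = γ * w t * (g t * α t / a t) * M := by rw [← hYM]; ring
    have e2 := mul_nonneg (mul_nonneg hwt.le hcs) hwst.le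
    have e3 : w t * (g t * α t / a t) * (p + 1 - 2 * γ * M) < 0 :=
      mul_neg_of_pos_of_neg (mul_pos hwt hy) (by nlinarith)
    linarith
  have hinv : ∀ t, 0 ≤ t → (g t)⁻¹ ≤ (g 0)⁻¹ + 2 * γ * L * (w t * (1 + t)) := fun T hT => by
    have := le_initial_of_deriv_nonpos_Ici
      (f := fun t => (g t)⁻¹ - 2 * γ * L * (w t * (1 + t)))
      (fun t ht => ((S.g_deriv t ht (ha t ht)).inv (hg t ht).ne').sub
        ((hws t ht).const_mul (2 * γ * L))) (fun t ht => by
        have hat := ha t ht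
        have hgt := hg t ht
        have e1 : -(γ * (g t / a t) * (-2 * (w t * g t * α t))) / g t ^ 2
            = 2 * γ * w t * (α t / a t) := by
          field_simp
        have e2 : α t / a t ≤ L := (div_le_iff₀ hat).2 (S.α_le t ht)
        have e3 : 0 ≤ 2 * γ * w t := by have := hw t ht; positivity
        have e4 := mul_le_mul_of_nonneg_left e2 e3
        have e5 : 0 ≤ 2 * γ * L * (p * w t) := by have := hw t ht; positivity
        rw [e1]
        linarith) hT
    have h1 : 0 ≤ 2 * γ * L * (w 0 * (1 + 0)) := by positivity
    linarith
  have hg0 := hg 0 le_rfl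
  set K := M + (g 0)⁻¹ + 2 * γ * L with hK
  have hKpos : 0 < K := by positivity
  refine ⟨K, hKpos, fun t ht => ⟨?_, ?_⟩, fun t => w t ^ 4 * g t ^ 2 * σ t
    + 2 * (w t ^ 3 / (1 + t)) * (g t * α t) + (2 + (1 + 2 * γ * K) ^ 2) * a t, _, fun t ht =>
    (((((S.w_deriv t ht).fun_pow 4).fun_mul ((S.g_deriv t ht (ha t ht)).fun_pow 2)).fun_mul
      (S.σ_deriv t ht)).fun_add (((((S.w_deriv t ht).fun_pow 3).fun_div (hs t ht)
      (by linarith)).const_mul 2).fun_mul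
      ((S.g_deriv t ht (ha t ht)).fun_mul (S.α_deriv t ht)))).fun_add
      ((S.a_deriv t ht).const_mul _), fun t ht => ?_, fun t ht => ?_⟩
  · have h1 := hydec t ht
    rw [div_mul_eq_mul_div, div_le_iff₀ (ha t ht)] at h1
    refine h1.trans (mul_le_mul_of_nonneg_right ?_ (ha t ht).le)
    have : 0 ≤ 2 * γ * L := by positivity
    have := inv_pos.2 hg0
    linarith
  · have h1 := hinv t ht
    have h2 : 1 ≤ w t * (1 + t) := by nlinarith [S.one_le_w t ht]
    have h3 : (g t)⁻¹ ≤ K * (w t * (1 + t)) := by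
      have e1 : (g 0)⁻¹ * 1 ≤ (g 0)⁻¹ * (w t * (1 + t)) := by gcongr
      have e2 : 0 ≤ M * (w t * (1 + t)) := by positivity
      rw [hK]
      linarith
    have := mul_le_mul_of_nonneg_right h3 (hg t ht).le
    rwa [inv_mul_cancel₀ (hg t ht).ne'] at this
  · have hat := ha t ht
    have hgt := hg t ht
    have hwt := hw t ht
    have hαt := S.α_nonneg t ht
    have hσt := S.σ_nonneg t ht
    have hst : 0 < 1 + t := by linarith
    have e1 : 0 ≤ (1 - p) * (w t ^ 4 * g t ^ 2 * σ t / (1 + t)) :=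
      mul_nonneg (by linarith) (by positivity)
    have e2 : 0 ≤ w t ^ 5 * γ * g t ^ 3 * α t * σ t / a t := by positivity
    have e3 : 0 ≤ w t ^ 4 * γ * g t ^ 2 * α t ^ 2 / ((1 + t) * a t) := by positivity
    have e4 : (3 * p - 1) * (w t ^ 3 / (1 + t) ^ 2 * (g t * α t)) ≤ 2 * (w t * (g t * α t)) := by
      have h1 : w t ^ 3 / (1 + t) ^ 2 ≤ w t := by
        rw [div_le_iff₀ (by positivity)]
        have := S.w_le t ht
        calc w t ^ 3 = w t * w t ^ 2 := by ring
          _ ≤ _ := by gcongr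
      have h2 : w t ^ 3 / (1 + t) ^ 2 * (g t * α t) ≤ w t * (g t * α t) := by gcongr
      have h3 : 0 ≤ w t ^ 3 / (1 + t) ^ 2 * (g t * α t) := by positivity
      nlinarith
    calc _ = -(2 * w t ^ 5 * g t ^ 3 * τ t + 2 * (1 + 2 * γ * K) ^ 2 * (w t * g t * α t))
          - 4 * ((1 - p) * (w t ^ 4 * g t ^ 2 * σ t / (1 + t)))
          - 4 * (w t ^ 5 * γ * g t ^ 3 * α t * σ t / a t)
          - 4 * (w t ^ 4 * γ * g t ^ 2 * α t ^ 2 / ((1 + t) * a t))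
          + 2 * ((3 * p - 1) * (w t ^ 3 / (1 + t) ^ 2 * (g t * α t)) - 2 * (w t * (g t * α t)))
          := by
          push_cast
          field_simp
          ring
      _ ≤ _ := by linarith
  · have hat := ha t ht
    have hgt := hg t ht
    have hwt := hw t ht
    have hαt := S.α_nonneg t ht
    have hσt := S.σ_nonneg t ht
    have hst : 0 < 1 + t := by linarith
    positivity

end ParScalars

section Parabolic

variable {H : Type*} [NormedAddCommGroup H] [InnerProductSpace ℝ H] {A : H →L[ℝ] H}
  {p γ : ℝ} {u₀ : H} {u u' : ℝ → H}

theorem IsParSolution.velocity_eq (hu : IsParSolution A p γ u₀ u u') {t : ℝ} (ht : 0 ≤ t) :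
    u' t = -((1 + t) ^ p * ⟪A (u t), u t⟫ ^ γ) • A (u t) := by
  rw [neg_smul]
  exact eq_neg_of_add_eq_zero_left (hu.2.2.2 t ht)

theorem IsParSolution.hasDerivWithinAt_clm_map (hu : IsParSolution A p γ u₀ u u') {t : ℝ}
    (ht : 0 ≤ t) : HasDerivWithinAt (fun t => A (u t))
      (-((1 + t) ^ p * ⟪A (u t), u t⟫ ^ γ) • A (A (u t))) (Set.Ici 0) t := by
  refine (hu.2.1 t ht).clm_map.congr_deriv ?_
  rw [hu.velocity_eq ht, map_smul]

theorem IsParSolution.parScalars (hu : IsParSolution A p γ u₀ u u')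
    (hsa : ∀ x y : H, ⟪A x, y⟫ = ⟪x, A y⟫) (hnn : ∀ x : H, 0 ≤ ⟪A x, x⟫)
    (hp0 : 0 ≤ p) (hp1 : p ≤ 1) (hγ : 0 ≤ γ) :
    ParScalars p γ ‖A‖ (fun t => (1 + t) ^ p) (fun t => ⟪A (u t), u t⟫)
      (fun t => ⟪A (u t), u t⟫ ^ γ) (fun t => ‖A (u t)‖ ^ 2) (fun t => ⟪A (A (u t)), A (u t)⟫)
      (fun t => ‖A (A (u t))‖ ^ 2) := by
  have da : ∀ t, 0 ≤ t → HasDerivWithinAt (fun t => ⟪A (u t), u t⟫)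
      (-2 * ((1 + t) ^ p * ⟪A (u t), u t⟫ ^ γ * ‖A (u t)‖ ^ 2)) (Set.Ici 0) t := fun t ht => by
    refine ((hu.2.1 t ht).inner_map_self hsa).congr_deriv ?_
    rw [hu.velocity_eq ht, real_inner_smul_right, real_inner_self_eq_norm_sq]
    ring
  exact {
    w_deriv := fun t ht => hasDerivWithinAt_one_add_rpow p ht
    one_le_w := fun t ht => one_le_one_add_rpow hp0 ht
    w_le := fun t ht => one_add_rpow_le hp1 ht
    a_deriv := da
    α_deriv := fun t ht => by
      refine (hu.hasDerivWithinAt_clm_map ht).norm_sq'.congr_deriv ?_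
      rw [real_inner_smul_left]
      ring
    σ_deriv := fun t ht => by
      refine ((hu.hasDerivWithinAt_clm_map ht).inner_map_self hsa).congr_deriv ?_
      rw [real_inner_smul_right, real_inner_self_eq_norm_sq]
      ring
    g_deriv := fun t ht ha => by
      refine ((da t ht).rpow_const (p := γ) (Or.inl ha.ne')).congr_deriv ?_
      rw [Real.rpow_sub_one ha.ne']
      ring
    a_nonneg := fun t _ => hnn _
    g_nonneg := fun t _ => Real.rpow_nonneg (hnn _) γ
    g_pos := fun t _ ha => Real.rpow_pos_of_pos ha γ
    g_mono := fun t _ h => Real.rpow_le_rpow (hnn _) h hγ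
    α_nonneg := fun t _ => sq_nonneg _
    σ_nonneg := fun t _ => hnn _
    τ_nonneg := fun t _ => sq_nonneg _
    α_le := fun t _ => norm_map_sq_le hsa hnn _
    α_sq_le := fun t _ => by
      have := inner_map_sq_le hsa hnn (u t) (A (u t))
      rwa [real_inner_self_eq_norm_sq] at this }

/-- Decay and regularity estimates for parabolic solutions. -/
theorem IsParSolution.exists_estimates (hu : IsParSolution A p γ u₀ u u')
    (hsa : ∀ x y : H, ⟪A x, y⟫ = ⟪x, A y⟫) (hnn : ∀ x : H, 0 ≤ ⟪A x, x⟫)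
    (hp0 : 0 ≤ p) (hp1 : p ≤ 1) (hγ : 1 ≤ γ) (hmdg : 0 < ⟪A u₀, u₀⟫) :
    ∃ K > 0, (∀ t, 0 ≤ t → 0 < ⟪A (u t), u t⟫ ∧
        ⟪A (u t), u t⟫ ^ γ * ‖A (u t)‖ ^ 2 * ((1 + t) ^ p * (1 + t)) ≤ K * ⟪A (u t), u t⟫ ∧
        1 ≤ K * ((1 + t) ^ p * (1 + t)) * ⟪A (u t), u t⟫ ^ γ ∧
        ‖u' t‖ ^ 2 * (1 + t) ≤ K * (1 + t) ^ p * (⟪A (u t), u t⟫ * ⟪A (u t), u t⟫ ^ γ)) ∧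
      ∃ (v' : ℝ → H) (Θ Θ' : ℝ → ℝ), (∀ t, 0 ≤ t → HasDerivWithinAt u' (v' t) (Set.Ici 0) t) ∧
        (∀ t, 0 ≤ t → HasDerivWithinAt Θ (Θ' t) (Set.Ici 0) t) ∧
        (∀ t, 0 ≤ t → Θ' t ≤ -((1 + t) ^ p * ‖v' t‖ ^ 2 / ⟪A (u t), u t⟫ ^ γ)) ∧
        ∀ t, 0 ≤ t → 0 ≤ Θ t := by
  have S := hu.parScalars hsa hnn hp0 hp1 (by linarith)
  have h0 : 0 < ⟪A (u 0), u 0⟫ := by rwa [hu.1]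
  have ha : ∀ t, 0 ≤ t → 0 < ⟪A (u t), u t⟫ := fun t ht => S.a_pos h0 ht
  obtain ⟨K, hK, hest, Θ, Θ', hΘd, hΘ', hΘ⟩ := S.exists_estimates hp0 hp1 hγ (norm_nonneg A) h0
  refine ⟨K, hK, fun t ht => ⟨ha t ht, (hest t ht).1, (hest t ht).2, ?_⟩, fun t =>
    -(((1 + t) ^ p * ⟪A (u t), u t⟫ ^ γ) • (-((1 + t) ^ p * ⟪A (u t), u t⟫ ^ γ) • A (A (u t)))
      + (p * (1 + t) ^ p / (1 + t) * ⟪A (u t), u t⟫ ^ γ + (1 + t) ^ p *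
        (γ * (⟪A (u t), u t⟫ ^ γ / ⟪A (u t), u t⟫) *
          (-2 * ((1 + t) ^ p * ⟪A (u t), u t⟫ ^ γ * ‖A (u t)‖ ^ 2)))) • A (u t)),
    Θ, Θ', fun t ht => ?_, hΘd, fun t ht => (hΘ' t ht).trans (neg_le_neg ?_), hΘ⟩
  · rw [hu.velocity_eq ht, norm_smul, mul_pow, Real.norm_eq_abs, sq_abs]
    have hw : (0 : ℝ) < (1 + t) ^ p := Real.rpow_pos_of_pos (by linarith) p
    have := mul_le_mul_of_nonneg_left (hest t ht).1
      (mul_pos hw (S.g_pos t ht (ha t ht))).le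
    linarith
  · refine HasDerivWithinAt.congr (f := fun t => -(((1 + t) ^ p * ⟪A (u t), u t⟫ ^ γ) • A (u t)))
      ?_ (fun s hs => ?_) ?_
    · exact ((((S.w_deriv t ht).fun_mul (S.g_deriv t ht (ha t ht))).fun_smul
        (hu.hasDerivWithinAt_clm_map ht))).fun_neg
    · rw [hu.velocity_eq hs, neg_smul]
    · rw [hu.velocity_eq ht, neg_smul]
  · have hK1 := (hest t ht).1
    have hat := ha t ht
    have hg := S.g_pos t ht hat
    have hw : (1 : ℝ) ≤ (1 + t) ^ p := S.one_le_w t ht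
    have hws : (1 + t) ^ p ≤ 1 + t := S.w_le t ht
    set w := (1 + t) ^ p
    set s := 1 + t
    set a := ⟪A (u t), u t⟫
    set g := a ^ γ
    have hs : 0 < s := by linarith
    have hw0 : 0 < w := by linarith
    have hα : 0 ≤ ‖A (u t)‖ ^ 2 := sq_nonneg _
    set c := p * w / s * g + w * (γ * (g / a) * (-2 * (w * g * ‖A (u t)‖ ^ 2))) with hc
    have hcle : |c| ≤ w * g / s * (1 + 2 * γ * K) := by
      have e1 : c = w * g / s * (p - 2 * γ * (g * ‖A (u t)‖ ^ 2 * (w * s) / a)) := by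
        rw [hc]; field_simp; ring
      have e2 : g * ‖A (u t)‖ ^ 2 * (w * s) / a ≤ K := (div_le_iff₀ hat).2 hK1
      have e3 : 0 ≤ g * ‖A (u t)‖ ^ 2 * (w * s) / a := by positivity
      have e4 : 2 * γ * (g * ‖A (u t)‖ ^ 2 * (w * s) / a) ≤ 2 * γ * K := by gcongr
      have e5 : 0 ≤ 2 * γ * (g * ‖A (u t)‖ ^ 2 * (w * s) / a) := by positivity
      rw [e1, abs_mul, abs_of_pos (by positivity)]
      refine mul_le_mul_of_nonneg_left (abs_le.2 ⟨?_, ?_⟩) (by positivity) <;> linarith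
    have hc2 : c ^ 2 ≤ (w * g / s * (1 + 2 * γ * K)) ^ 2 := by
      rw [← sq_abs]; gcongr
    have hnorm : ‖-((w * g) • (-(w * g) • A (A (u t))) + c • A (u t))‖ ^ 2
        ≤ 2 * (w ^ 4 * g ^ 4 * ‖A (A (u t))‖ ^ 2) + 2 * (c ^ 2 * ‖A (u t)‖ ^ 2) := by
      rw [norm_neg, smul_smul]
      calc _ ≤ (‖(w * g * -(w * g)) • A (A (u t))‖ + ‖c • A (u t)‖) ^ 2 := by
            gcongr; exact norm_add_le _ _
        _ ≤ 2 * (‖(w * g * -(w * g)) • A (A (u t))‖ ^ 2 + ‖c • A (u t)‖ ^ 2) := add_sq_le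
        _ = _ := by
          rw [norm_smul, norm_smul, mul_pow, mul_pow, Real.norm_eq_abs, Real.norm_eq_abs, sq_abs,
            sq_abs]
          ring
    rw [div_le_iff₀ hg]
    have e1 : c ^ 2 * ‖A (u t)‖ ^ 2 ≤ (1 + 2 * γ * K) ^ 2 * (g ^ 2 * ‖A (u t)‖ ^ 2) := by
      have : (w * g / s * (1 + 2 * γ * K)) ^ 2 ≤ (1 + 2 * γ * K) ^ 2 * g ^ 2 := by
        have : w / s ≤ 1 := (div_le_one hs).2 hws
        have h2 : (w / s) ^ 2 ≤ 1 := pow_le_one₀ (by positivity) this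
        calc _ = (w / s) ^ 2 * ((1 + 2 * γ * K) ^ 2 * g ^ 2) := by ring
          _ ≤ 1 * ((1 + 2 * γ * K) ^ 2 * g ^ 2) := by gcongr
          _ = _ := one_mul _
      have := mul_le_mul_of_nonneg_right (hc2.trans this) hα
      linarith
    have e2 := mul_le_mul_of_nonneg_left (hnorm.trans (add_le_add_right
      (mul_le_mul_of_nonneg_left e1 zero_le_two) _)) hw0.le
    simp only
    linarith

end Parabolic

section Comparison

variable {H : Type*} [NormedAddCommGroup H] [InnerProductSpace ℝ H] {A : H →L[ℝ] H}

theorem inner_map_add_le (hsa : ∀ x y : H, ⟪A x, y⟫ = ⟪x, A y⟫) (hnn : ∀ x : H, 0 ≤ ⟪A x, x⟫)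
    (x y : H) : ⟪A (x + y), x + y⟫ ≤ 2 * (⟪A x, x⟫ + ⟪A y, y⟫) := by
  have h := hnn (x - y)
  have hxy : ⟪A y, x⟫ = ⟪A x, y⟫ := by rw [hsa, real_inner_comm]
  simp only [map_add, map_sub, inner_add_left, inner_add_right, inner_sub_left, inner_sub_right,
    hxy] at h ⊢
  linarith

theorem sq_inner_map_sub_le (hsa : ∀ x y : H, ⟪A x, y⟫ = ⟪x, A y⟫)
    (hnn : ∀ x : H, 0 ≤ ⟪A x, x⟫) (x y : H) :
    (⟪A x, x⟫ - ⟪A y, y⟫) ^ 2 ≤ ⟪A (x - y), x - y⟫ * (2 * (⟪A x, x⟫ + ⟪A y, y⟫)) := by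
  have h : ⟪A x, x⟫ - ⟪A y, y⟫ = ⟪A (x - y), x + y⟫ := by
    have hxy : ⟪A y, x⟫ = ⟪A x, y⟫ := by rw [hsa, real_inner_comm]
    simp only [map_sub, inner_add_right, inner_sub_left, hxy]
    ring
  rw [h]
  exact (inner_map_sq_le hsa hnn _ _).trans
    (mul_le_mul_of_nonneg_left (inner_map_add_le hsa hnn x y) (hnn _))

theorem abs_rpow_sub_rpow_le {γ a b : ℝ} (hγ : 1 ≤ γ) (ha : 0 < a) (hb : 0 < b)
    (hab : a ≤ 4 * b) : |a ^ γ - b ^ γ| ≤ γ * (4 ^ γ * (b ^ γ / b)) * |a - b| := by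
  have hbγ := Real.rpow_pos_of_pos hb γ
  have h4 : (1 : ℝ) ≤ 4 ^ γ := Real.one_le_rpow (by norm_num) (by linarith)
  have h1 : a ^ γ / a ≤ 4 ^ γ * (b ^ γ / b) := by
    calc a ^ γ / a = a ^ (γ - 1) := (Real.rpow_sub_one ha.ne' γ).symm
      _ ≤ (4 * b) ^ (γ - 1) := Real.rpow_le_rpow ha.le hab (by linarith)
      _ = 4 ^ γ * (b ^ γ / b) / 4 := by
        rw [Real.mul_rpow (by norm_num) hb.le, Real.rpow_sub_one hb.ne',
          Real.rpow_sub_one (by norm_num)]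
        ring
      _ ≤ _ := by
        have : 0 ≤ 4 ^ γ * (b ^ γ / b) := by positivity
        linarith
  have h2 : b ^ γ / b ≤ 4 ^ γ * (b ^ γ / b) := le_mul_of_one_le_left (by positivity) h4
  have hγ0 : 0 ≤ γ := by linarith
  refine abs_sub_le_iff.2 ⟨?_, ?_⟩
  · refine (rpow_sub_rpow_le hγ hb.le ha).trans ?_
    have := le_abs_self (a - b)
    calc _ ≤ γ * (a ^ γ / a) * |a - b| := by gcongr
      _ ≤ _ := by gcongr
  · refine (rpow_sub_rpow_le hγ ha.le hb).trans ?_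
    have := neg_le_abs (a - b)
    calc _ ≤ γ * (b ^ γ / b) * |a - b| := by gcongr; linarith
      _ ≤ _ := by gcongr

/-- The difference of the nonlinear terms is controlled by the coercivity of
`half_mul_inner_le_inner_sub`. -/
theorem norm_sq_rpow_smul_sub_le (hsa : ∀ x y : H, ⟪A x, y⟫ = ⟪x, A y⟫)
    (hnn : ∀ x : H, 0 ≤ ⟪A x, x⟫) {γ C K W : ℝ} (hγ : 1 ≤ γ) (hC : 0 ≤ C) (hK : 0 ≤ K) {x y : H}
    (hx : 0 < ⟪A x, x⟫) (hy : 0 < ⟪A y, y⟫)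
    (hxW : ⟪A x, x⟫ ^ γ * ‖A x‖ ^ 2 * W ≤ C * ⟪A x, x⟫) (hyW : 1 ≤ K * W * ⟪A y, y⟫ ^ γ) :
    ‖⟪A x, x⟫ ^ γ • A x - ⟪A y, y⟫ ^ γ • A y‖ ^ 2
      ≤ (‖A‖ * (2 + 80 * (γ * 4 ^ γ) ^ 2) + 8 * K * C) *
        (⟪A y, y⟫ ^ γ * ((⟪A x, x⟫ ^ γ + ⟪A y, y⟫ ^ γ) * ⟪A (x - y), x - y⟫)) := by
  have hsq := sq_inner_map_sub_le hsa hnn x y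
  have htri : ⟪A x, x⟫ ≤ 2 * (⟪A (x - y), x - y⟫ + ⟪A y, y⟫) := by
    simpa using inner_map_add_le hsa hnn (x - y) y
  have hAx := norm_map_sq_le hsa hnn x
  have hAy := norm_map_sq_le hsa hnn y
  have hAd := norm_map_sq_le hsa hnn (x - y)
  have hd := hnn (x - y)
  have hg := Real.rpow_pos_of_pos hx γ
  have hg₀ := Real.rpow_pos_of_pos hy γ
  have hrpow := abs_rpow_sub_rpow_le hγ hx hy
  have hL := norm_nonneg A
  set a := ⟪A x, x⟫
  set b := ⟪A y, y⟫
  set d := ⟪A (x - y), x - y⟫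
  set g := a ^ γ
  set g₀ := b ^ γ
  have hnorm : ∀ (r : ℝ) (z : H), ‖r • z‖ ^ 2 = r ^ 2 * ‖z‖ ^ 2 := fun r z => by
    rw [norm_smul, mul_pow, Real.norm_eq_abs, sq_abs]
  have hgg : 0 ≤ g₀ * (g * d) := by positivity
  have hg0g0 : 0 ≤ g₀ * (g₀ * d) := by positivity
  have hLγ : 0 ≤ ‖A‖ * (80 * (γ * 4 ^ γ) ^ 2) := by positivity
  have hKC : 0 ≤ 8 * K * C := by positivity
  rcases le_or_gt a (4 * b) with hab | hab
  · have e1 : g • A x - g₀ • A y = g₀ • A (x - y) + (g - g₀) • A x := by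
      rw [map_sub, smul_sub, sub_smul]; abel
    have e2 : (g - g₀) ^ 2 * a ≤ 40 * (γ * 4 ^ γ) ^ 2 * (g₀ ^ 2 * d) := by
      have h1 : (g - g₀) ^ 2 ≤ (γ * (4 ^ γ * (g₀ / b))) ^ 2 * (a - b) ^ 2 := by
        rw [← sq_abs (g - g₀), ← sq_abs (a - b), ← mul_pow]
        gcongr
        exact hrpow hab
      have h2 : (a - b) ^ 2 ≤ 10 * b * d := by nlinarith
      calc _ ≤ (γ * (4 ^ γ * (g₀ / b))) ^ 2 * (10 * b * d) * (4 * b) := by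
            gcongr
            exact h1.trans (by gcongr)
        _ = _ := by field_simp; ring
    calc _ ≤ (‖g₀ • A (x - y)‖ + ‖(g - g₀) • A x‖) ^ 2 := by
          rw [e1]; gcongr; exact norm_add_le _ _
      _ ≤ 2 * (‖g₀ • A (x - y)‖ ^ 2 + ‖(g - g₀) • A x‖ ^ 2) := add_sq_le
      _ = 2 * (g₀ ^ 2 * ‖A (x - y)‖ ^ 2 + (g - g₀) ^ 2 * ‖A x‖ ^ 2) := by rw [hnorm, hnorm]
      _ ≤ 2 * (g₀ ^ 2 * (‖A‖ * d) + (g - g₀) ^ 2 * (‖A‖ * a)) := by gcongr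
      _ = 2 * ‖A‖ * (g₀ ^ 2 * d + (g - g₀) ^ 2 * a) := by ring
      _ ≤ 2 * ‖A‖ * (g₀ ^ 2 * d + 40 * (γ * 4 ^ γ) ^ 2 * (g₀ ^ 2 * d)) := by gcongr
      _ = ‖A‖ * (2 + 80 * (γ * 4 ^ γ) ^ 2) * (g₀ * (g₀ * d)) := by ring
      _ ≤ _ := by
        have := mul_nonneg (add_nonneg (by positivity : 0 ≤ ‖A‖ * (2 + 80 * (γ * 4 ^ γ) ^ 2)) hKC)
          hgg
        have := mul_nonneg hKC hg0g0
        linarith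
  · have had : a ≤ 4 * d := by linarith
    have hbd : b ≤ d := by linarith
    have e1 : g ^ 2 * ‖A x‖ ^ 2 ≤ 4 * K * C * (g₀ * (g * d)) := by
      calc g ^ 2 * ‖A x‖ ^ 2 = g * (g * ‖A x‖ ^ 2) * 1 := by ring
        _ ≤ g * (g * ‖A x‖ ^ 2) * (K * W * g₀) := by gcongr
        _ = K * g * g₀ * (g * ‖A x‖ ^ 2 * W) := by ring
        _ ≤ K * g * g₀ * (C * (4 * d)) := by
          refine mul_le_mul_of_nonneg_left (hxW.trans ?_) (by positivity)
          gcongr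
        _ = _ := by ring
    calc _ ≤ (‖g • A x‖ + ‖g₀ • A y‖) ^ 2 := by gcongr; exact norm_sub_le _ _
      _ ≤ 2 * (‖g • A x‖ ^ 2 + ‖g₀ • A y‖ ^ 2) := add_sq_le
      _ = 2 * (g ^ 2 * ‖A x‖ ^ 2 + g₀ ^ 2 * ‖A y‖ ^ 2) := by rw [hnorm, hnorm]
      _ ≤ 2 * (4 * K * C * (g₀ * (g * d)) + g₀ ^ 2 * (‖A‖ * d)) := by
        gcongr
        exact hAy.trans (by gcongr)
      _ ≤ _ := by
        have := mul_nonneg (add_nonneg hLγ hKC) hg0g0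
        have := mul_nonneg (add_nonneg hLγ (by positivity : 0 ≤ 2 * ‖A‖)) hgg
        linarith

end Comparison

section Convergence

theorem difference_cross_term_le {p ε w s g₀ d b z : ℝ} (hp0 : 0 ≤ p) (hp1 : p ≤ 1)
    (hε : 0 < ε) (hε1 : ε ≤ 1 / 2) (hw0 : 0 ≤ w) (hs : 0 < s) (hwst : w ≤ s) (hg₀ : 0 ≤ g₀)
    (hd : 0 ≤ d) (ha₀ : 0 ≤ b) (hcs : z ^ 2 ≤ b * d) :
    -(ε * (p * (w / s)) * (w * g₀ * z)) ≤ 1 / 4 * (w * (g₀ * d)) + ε * (w * (b * g₀)) := by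
  have hq : w / s ≤ 1 := (div_le_one hs).2 hwst
  have h1 : |ε * z| ≤ 1 / 4 * d + ε ^ 2 * b := by
    refine abs_le_of_sq_le_sq ?_ (by positivity)
    have := mul_le_mul_of_nonneg_left hcs (sq_nonneg ε)
    nlinarith [sq_nonneg (1 / 4 * d - ε ^ 2 * b)]
  have h2 : p * (w / s) ≤ 1 := mul_le_one₀ hp1 (by positivity) hq
  have h3 : -(p * (w / s) * (ε * z)) ≤ 1 / 4 * d + ε * b := by
    calc _ ≤ |p * (w / s) * (ε * z)| := neg_le_abs _
      _ = p * (w / s) * |ε * z| := by rw [abs_mul, abs_of_nonneg (by positivity)]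
      _ ≤ 1 * |ε * z| := by gcongr
      _ ≤ 1 / 4 * d + ε ^ 2 * b := by rw [one_mul]; exact h1
      _ ≤ _ := by
        have : ε ^ 2 ≤ ε := by nlinarith
        gcongr
  have := mul_le_mul_of_nonneg_left h3 (mul_nonneg hw0 hg₀)
  linarith

theorem difference_momentum_le {ε w s v r y k C : ℝ} (hε : 0 < ε) (hε1 : ε ≤ 1 / 2)
    (hC : 0 ≤ C) (hw0 : 0 ≤ w) (hwst : w ≤ s) (hag : 0 ≤ k)
    (hin : |y| ≤ v * r) (hv : v ^ 2 * s ≤ C * w * k) (hde : w * s * k ≤ C) :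
    -(ε * (w * y)) ≤ 2 * C ^ 2 * ε + 1 / 8 * r ^ 2 := by
  have h1 : (w * v) ^ 2 ≤ C ^ 2 := by
    calc (w * v) ^ 2 = w * (v ^ 2 * w) := by ring
      _ ≤ w * (v ^ 2 * s) := by gcongr
      _ ≤ w * (C * w * k) := by gcongr
      _ ≤ w * (C * s * k) := by gcongr
      _ = C * (w * s * k) := by ring
      _ ≤ C * C := by gcongr
      _ = _ := by ring
  have e1 : -(w * y) ≤ w * v * r := by
    have := mul_le_mul_of_nonneg_left ((neg_le_abs _).trans hin) hw0
    linarith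
  have e2 := mul_le_mul_of_nonneg_left e1 hε.le
  have e3 : ε ^ 2 * (w * v) ^ 2 ≤ ε * C ^ 2 := by
    have : ε ^ 2 ≤ ε := by nlinarith
    gcongr
  nlinarith [sq_nonneg (4 * (ε * (w * v)) - r)]

variable {H : Type*} [NormedAddCommGroup H] [InnerProductSpace ℝ H] {A : H →L[ℝ] H}
  {p γ ε : ℝ} {u₀ u₁ : H} {u u' x x' x'' θ θ' θ'' : ℝ → H}

theorem IsParSolution.hasDerivWithinAt_norm_sq (hu : IsParSolution A p γ u₀ u u') {t : ℝ}
    (ht : 0 ≤ t) : HasDerivWithinAt (fun t => ‖u t‖ ^ 2)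
      (-2 * ((1 + t) ^ p * (⟪A (u t), u t⟫ * ⟪A (u t), u t⟫ ^ γ))) (Set.Ici 0) t := by
  refine (hu.2.1 t ht).norm_sq'.congr_deriv ?_
  rw [hu.velocity_eq ht, real_inner_smul_left]
  ring

theorem IsParSolution.norm_sq_le (hu : IsParSolution A p γ u₀ u u')
    (hnn : ∀ x : H, 0 ≤ ⟪A x, x⟫) {t : ℝ} (ht : 0 ≤ t) : ‖u t‖ ^ 2 ≤ ‖u₀‖ ^ 2 := by
  have := le_initial_of_deriv_nonpos_Ici (fun t ht => hu.hasDerivWithinAt_norm_sq ht)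
    (fun s hs => by
      have := mul_nonneg (Real.rpow_nonneg (by linarith : 0 ≤ 1 + s) p)
        (mul_nonneg (hnn (u s)) (Real.rpow_nonneg (hnn (u s)) γ))
      linarith) ht
  rwa [hu.1] at this

/-- A Lyapunov functional controlling the difference of a hyperbolic and a parabolic solution. -/
theorem exists_difference_energy (hsa : ∀ x y : H, ⟪A x, y⟫ = ⟪x, A y⟫)
    (hnn : ∀ x : H, 0 ≤ ⟪A x, x⟫) (hp0 : 0 ≤ p) (hp1 : p ≤ 1) (hγ : 1 ≤ γ)
    (hx : IsHypSolution A p γ ε u₀ u₁ x x' x'') (hu : IsParSolution A p γ u₀ u u')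
    (hε : 0 < ε) (hε1 : ε ≤ 1 / 2) {C K : ℝ} (hC : 0 < C) (hK : 0 < K)
    (hvel : ∀ t, 0 ≤ t →
      ‖x' t‖ ^ 2 * (1 + t) ≤ C * (1 + t) ^ p * (⟪A (x t), x t⟫ * ⟪A (x t), x t⟫ ^ γ))
    (hxC : ∀ t, 0 ≤ t → ‖x t‖ ^ 2 ≤ C)
    (hdec : ∀ t, 0 ≤ t →
      (1 + t) ^ p * (1 + t) * (⟪A (x t), x t⟫ * ⟪A (x t), x t⟫ ^ γ) ≤ C)
    (huvel : ∀ t, 0 ≤ t →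
      ‖u' t‖ ^ 2 * (1 + t) ≤ K * (1 + t) ^ p * (⟪A (u t), u t⟫ * ⟪A (u t), u t⟫ ^ γ))
    {J J' : ℝ → ℝ} (hJd : ∀ t, 0 ≤ t → HasDerivWithinAt J (J' t) (Set.Ici 0) t)
    (hJ' : ∀ t, 0 ≤ t →
      J' t ≤ -(1 / 2 * ((1 + t) ^ p * (⟪A (x t), x t⟫ * ⟪A (x t), x t⟫ ^ γ))))
    (hJ : ∀ t, 0 ≤ t → 0 ≤ J t) (hJ0 : J 0 ≤ C) :
    ∃ F F' : ℝ → ℝ, (∀ t, 0 ≤ t → HasDerivWithinAt F (F' t) (Set.Ici 0) t) ∧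
      (∀ t, 0 ≤ t → F' t ≤ -(1 / 2 * ((1 + t) ^ p *
        ⟪⟪A (x t), x t⟫ ^ γ • A (x t) - ⟪A (u t), u t⟫ ^ γ • A (u t), x t - u t⟫))) ∧
      (∀ t, 0 ≤ t → ‖x t - u t‖ ^ 2 ≤ 8 * (F t + 2 * C ^ 2 * ε)) ∧
      F 0 ≤ (C + ‖u₀‖ ^ 2 + 4 * C ^ 2 + (K + 1) / 2 * ‖u₀‖ ^ 2) * ε := by
  have hX : ∀ t, 0 ≤ t → ‖x t - u t‖ ^ 2 ≤ 2 * C + 2 * ‖u₀‖ ^ 2 := fun t ht => by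
    have h1 := hxC t ht
    have h2 := hu.norm_sq_le hnn ht
    calc _ ≤ (‖x t‖ + ‖u t‖) ^ 2 := by gcongr; exact norm_sub_le _ _
      _ ≤ 2 * (‖x t‖ ^ 2 + ‖u t‖ ^ 2) := add_sq_le
      _ ≤ _ := by linarith
  have hw : ∀ t : ℝ, 0 ≤ t → 1 ≤ (1 + t) ^ p := fun t ht => one_le_one_add_rpow hp0 ht
  have hws : ∀ t : ℝ, 0 ≤ t → (1 + t) ^ p ≤ 1 + t := fun t ht => one_add_rpow_le hp1 ht
  have dq : ∀ t : ℝ, 0 ≤ t → HasDerivWithinAt (fun t : ℝ => (1 + t) ^ p / (1 + t))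
      (-((1 - p) * ((1 + t) ^ p / (1 + t) ^ 2))) (Set.Ici 0) t := fun t ht => by
    have h1t : 1 + t ≠ 0 := by linarith
    refine ((hasDerivWithinAt_one_add_rpow p ht).fun_div
      ((hasDerivWithinAt_id t (Set.Ici 0)).const_add 1) h1t).congr_deriv ?_
    simp only [id_eq]
    field_simp
    ring
  have dρ : ∀ t, 0 ≤ t → HasDerivWithinAt (fun t => x t - u t) (x' t - u' t) (Set.Ici 0) t :=
    fun t ht => (hx.2.2.1 t ht).fun_sub (hu.2.1 t ht)
  have dP : ∀ t, 0 ≤ t → HasDerivWithinAt (fun t => (1 + t) ^ p * ⟪x' t, x t - u t⟫)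
      (p * (1 + t) ^ p / (1 + t) * ⟪x' t, x t - u t⟫ + (1 + t) ^ p *
        (⟪x' t, x' t - u' t⟫ + ⟪x'' t, x t - u t⟫)) (Set.Ici 0) t := fun t ht =>
    (hasDerivWithinAt_one_add_rpow p ht).fun_mul ((hx.2.2.2.1 t ht).inner ℝ (dρ t ht))
  refine ⟨fun t => 1 / 2 * ‖x t - u t‖ ^ 2
      - ε * p / 2 * ((1 + t) ^ p / (1 + t) * ‖x t - u t‖ ^ 2)
      + ε * ((1 + t) ^ p * ⟪x' t, x t - u t⟫)
      + ε * p * (C + ‖u₀‖ ^ 2) * ((1 + t) ^ p / (1 + t)) + ε * (4 * C) * J t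
      + ε * ((K + 1) / 2) * ‖u t‖ ^ 2, _, fun t ht =>
    ((((((dρ t ht).norm_sq'.const_mul (1 / 2)).fun_sub
      (((dq t ht).fun_mul (dρ t ht).norm_sq').const_mul (ε * p / 2))).fun_add
      ((dP t ht).const_mul ε)).fun_add ((dq t ht).const_mul _)).fun_add
      ((hJd t ht).const_mul _)).fun_add ((hu.hasDerivWithinAt_norm_sq ht).const_mul _),
    fun t ht => ?_, fun t ht => ?_, ?_⟩
  · have hM := half_mul_inner_le_inner_sub hsa hnn (by linarith : 0 ≤ γ) (x t) (u t)
    have hcs := inner_map_sq_le hsa hnn (u t) (x t - u t)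
    have hd := hnn (x t - u t)
    have ha := hnn (x t)
    have ha₀ := hnn (u t)
    have hg := Real.rpow_nonneg ha γ
    have hg₀ := Real.rpow_nonneg ha₀ γ
    have hv := hvel t ht
    have huv := huvel t ht
    have hJt := hJ' t ht
    have hXt := hX t ht
    have hwt := hw t ht
    have hwst := hws t ht
    rw [hx.inner_acceleration hε ht]
    have hu' : ⟪u' t, x t - u t⟫
        = -((1 + t) ^ p * ⟪A (u t), u t⟫ ^ γ * ⟪A (u t), x t - u t⟫) := by
      rw [hu.velocity_eq ht, real_inner_smul_left]; ring
    have hxu : ⟪x' t, x' t - u' t⟫ ≤ 2 * ‖x' t‖ ^ 2 + ‖u' t‖ ^ 2 := by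
      have h1 := real_inner_le_norm (x' t) (x' t - u' t)
      have h2 := mul_le_mul_of_nonneg_left (norm_sub_le (x' t) (u' t)) (norm_nonneg (x' t))
      nlinarith [sq_nonneg (‖x' t‖ - ‖u' t‖), sq_nonneg ‖x' t‖, sq_nonneg ‖u' t‖]
    have hMeq : ⟪⟪A (x t), x t⟫ ^ γ • A (x t) - ⟪A (u t), u t⟫ ^ γ • A (u t), x t - u t⟫
        = ⟪A (x t), x t⟫ ^ γ * ⟪A (x t), x t - u t⟫
          - ⟪A (u t), u t⟫ ^ γ * ⟪A (u t), x t - u t⟫ := by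
      rw [inner_sub_left, real_inner_smul_left, real_inner_smul_left]
    rw [inner_sub_left (x' t) (u' t), hu', hMeq]
    rw [hMeq] at hM
    have hs : 0 < 1 + t := by linarith
    set w := (1 + t) ^ p
    set s := 1 + t
    set a := ⟪A (x t), x t⟫
    set b := ⟪A (u t), u t⟫
    set g := a ^ γ
    set g₀ := b ^ γ
    set d := ⟪A (x t - u t), x t - u t⟫
    set z := ⟪A (u t), x t - u t⟫
    set X := ‖x t - u t‖ ^ 2
    have hw0 : 0 < w := by linarith
    have b2 := difference_cross_term_le hp0 hp1 hε hε1 hw0.le hs hwst hg₀ hd ha₀ hcs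
    have b3 : w * ⟪x' t, x' t - u' t⟫ ≤ 2 * (C * w * (a * g)) + K * w * (b * g₀) := by
      have h1 := mul_le_mul_of_nonneg_left hxu hw0.le
      have h2 := mul_le_mul_of_nonneg_right hwst (sq_nonneg ‖x' t‖)
      have h3 := mul_le_mul_of_nonneg_right hwst (sq_nonneg ‖u' t‖)
      linarith
    have b4 := mul_le_mul_of_nonneg_left hXt (by
      have : 0 ≤ 1 - p := by linarith
      positivity : 0 ≤ ε / 2 * p * (1 - p) * (w / s ^ 2))
    have b5 := mul_le_mul_of_nonneg_left hJt (by positivity : 0 ≤ ε * (4 * C))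
    have b6 := mul_le_mul_of_nonneg_left b3 hε.le
    have b7 := mul_le_mul_of_nonneg_left hM hw0.le
    have b8 : 0 ≤ w * (g * d) := by positivity
    calc _ = -(w * (g * ⟪A (x t), x t - u t⟫ - g₀ * z)) - ε * (p * (w / s)) * (w * g₀ * z)
          + ε / 2 * p * (1 - p) * (w / s ^ 2) * X
          - ε / 2 * p * (1 - p) * (w / s ^ 2) * (2 * C + 2 * ‖u₀‖ ^ 2)
          + ε * (w * ⟪x' t, x' t - u' t⟫) + ε * (4 * C) * J' t
          - ε * (K + 1) * (w * (b * g₀)) := by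
            field_simp
            ring
      _ ≤ _ := by linarith
  · have hwt := hw t ht
    have hwst := hws t ht
    have hv := hvel t ht
    have hs : 0 < 1 + t := by linarith
    have hde := hdec t ht
    have hag : 0 ≤ ⟪A (x t), x t⟫ * ⟪A (x t), x t⟫ ^ γ :=
      mul_nonneg (hnn _) (Real.rpow_nonneg (hnn _) γ)
    have hJt := hJ t ht
    have hin : |⟪x' t, x t - u t⟫| ≤ ‖x' t‖ * ‖x t - u t‖ := abs_real_inner_le_norm _ _
    set w := (1 + t) ^ p
    set s := 1 + t
    have hw0 : 0 < w := by linarith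
    have hq : w / s ≤ 1 := (div_le_one hs).2 hwst
    have h2 := difference_momentum_le hε hε1 hC.le hw0.le hwst hag hin hv hde
    have h3 : ε * p / 2 * (w / s * ‖x t - u t‖ ^ 2) ≤ 1 / 4 * ‖x t - u t‖ ^ 2 := by
      calc _ ≤ 1 / 2 * 1 / 2 * (1 * ‖x t - u t‖ ^ 2) := by gcongr
        _ = _ := by ring
    have h4 : 0 ≤ ε * p * (C + ‖u₀‖ ^ 2) * (w / s) := by positivity
    have h5 : 0 ≤ ε * (4 * C) * J t := by positivity
    have h6 : 0 ≤ ε * ((K + 1) / 2) * ‖u t‖ ^ 2 := by positivity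
    linarith
  · simp only [hx.1, hu.1, sub_self, norm_zero, inner_zero_right, add_zero, Real.one_rpow]
    have h1 := mul_le_mul_of_nonneg_left hJ0 (by positivity : 0 ≤ ε * (4 * C))
    have h2 := mul_le_mul_of_nonneg_left hp1 (by positivity : 0 ≤ ε * (C + ‖u₀‖ ^ 2))
    linarith

end Convergence

section Residual

variable {H : Type*} [NormedAddCommGroup H] [InnerProductSpace ℝ H] {A : H →L[ℝ] H}
  {p γ ε : ℝ} {u₀ u₁ w₀ : H} {u u' v' x x' x'' θ θ' θ'' : ℝ → H}

/-- The velocity of `u_ε - u - θ_ε` solves a linear first order equation. -/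
theorem residual_velocity_deriv (hε : 0 < ε) (hx : IsHypSolution A p γ ε u₀ u₁ x x' x'')
    (hu : IsParSolution A p γ u₀ u u') (hθ : IsCorrector p ε w₀ θ θ' θ'')
    (hv : ∀ t, 0 ≤ t → HasDerivWithinAt u' (v' t) (Set.Ici 0) t) {t : ℝ} (ht : 0 ≤ t) :
    HasDerivWithinAt (fun t => x' t - u' t - θ' t)
      (-(1 / ε) • (((1 + t) ^ p)⁻¹ • (x' t - u' t - θ' t)
        + (⟪A (x t), x t⟫ ^ γ • A (x t) - ⟪A (u t), u t⟫ ^ γ • A (u t)) + ε • v' t))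
      (Set.Ici 0) t := by
  refine (((hx.2.2.2.1 t ht).fun_sub (hv t ht)).fun_sub (hθ.2.2.2.1 t ht)).congr_deriv ?_
  have hw : ((1 + t : ℝ) ^ p) ≠ 0 := (Real.rpow_pos_of_pos (by linarith) p).ne'
  have hθ'' : θ'' t = -(1 / ε) • ((1 + t) ^ p)⁻¹ • θ' t := by
    have h := eq_neg_of_add_eq_zero_left (hθ.2.2.2.2 t ht)
    rw [Real.rpow_neg (by linarith)] at h
    rw [neg_smul, ← smul_neg, ← h, smul_smul, one_div, inv_mul_cancel₀ hε.ne', one_smul]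
  rw [hx.acceleration_eq hε ht, hθ'', hu.velocity_eq ht]
  match_scalars <;> field_simp
  ring

theorem neg_two_mul_inner_le {w : ℝ} (hw : 0 < w) (m z : H) :
    -(2 * ⟪m, z⟫) ≤ ‖z‖ ^ 2 / (4 * w) + 4 * (w * ‖m‖ ^ 2) := by
  have h1 := neg_le_of_abs_le (abs_real_inner_le_norm m z)
  have h2 : ‖z‖ ^ 2 / (4 * w) + 4 * (w * ‖m‖ ^ 2) - 2 * (‖m‖ * ‖z‖)
      = (‖z‖ - 4 * w * ‖m‖) ^ 2 / (4 * w) := by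
    field_simp
    ring
  have h3 : 0 ≤ (‖z‖ - 4 * w * ‖m‖) ^ 2 / (4 * w) := by positivity
  linarith

/-- Energy estimate for the velocity of `u_ε - u - θ_ε`. -/
theorem exists_residual_energy (hε : 0 < ε) (hγ : 0 ≤ γ)
    (hsa : ∀ x y : H, ⟪A x, y⟫ = ⟪x, A y⟫) (hnn : ∀ x : H, 0 ≤ ⟪A x, x⟫)
    (hp0 : 0 ≤ p) (hp1 : p ≤ 1) (hx : IsHypSolution A p γ ε u₀ u₁ x x' x'')
    (hu : IsParSolution A p γ u₀ u u') (hθ : IsCorrector p ε w₀ θ θ' θ'')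
    (hv : ∀ t, 0 ≤ t → HasDerivWithinAt u' (v' t) (Set.Ici 0) t) {K : ℝ}
    (hεK : 4 * γ * K * ε ≤ 1) (ha : ∀ t, 0 ≤ t → 0 < ⟪A (u t), u t⟫)
    (hdec : ∀ t, 0 ≤ t →
      ⟪A (u t), u t⟫ ^ γ * ‖A (u t)‖ ^ 2 * ((1 + t) ^ p * (1 + t)) ≤ K * ⟪A (u t), u t⟫) :
    ∃ R' : ℝ → ℝ, (∀ t, 0 ≤ t → HasDerivWithinAt
        (fun t => ‖x' t - u' t - θ' t‖ ^ 2 / ⟪A (u t), u t⟫ ^ γ) (R' t) (Set.Ici 0) t) ∧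
      ∀ t, 0 ≤ t → ε * R' t ≤ -(‖x' t - u' t - θ' t‖ ^ 2 / ⟪A (u t), u t⟫ ^ γ / (1 + t) ^ p)
        + 4 * ((1 + t) ^ p * ‖⟪A (x t), x t⟫ ^ γ • A (x t) - ⟪A (u t), u t⟫ ^ γ • A (u t)‖ ^ 2
          / ⟪A (u t), u t⟫ ^ γ)
        + 4 * ε ^ 2 * ((1 + t) ^ p * ‖v' t‖ ^ 2 / ⟪A (u t), u t⟫ ^ γ) := by
  have S := hu.parScalars hsa hnn hp0 hp1 hγ
  refine ⟨_, fun t ht => (residual_velocity_deriv hε hx hu hθ hv ht).norm_sq'.fun_div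
    (S.g_deriv t ht (ha t ht)) (S.g_pos t ht (ha t ht)).ne', fun t ht => ?_⟩
  have hat := ha t ht
  have hg := S.g_pos t ht hat
  have hw : (0 : ℝ) < (1 + t) ^ p := zero_lt_one.trans_le (S.one_le_w t ht)
  have hws := S.w_le t ht
  have hd := hdec t ht
  simp only [real_inner_smul_left, inner_add_left, real_inner_self_eq_norm_sq] at hg hws ⊢
  set w := (1 + t) ^ p
  set η := x' t - u' t - θ' t
  set m := ⟪A (x t), x t⟫ ^ γ • A (x t) - ⟪A (u t), u t⟫ ^ γ • A (u t)
  set a := ⟪A (u t), u t⟫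
  set g := a ^ γ
  have h1 := neg_two_mul_inner_le hw m η
  have h2 := neg_two_mul_inner_le hw (ε • v' t) η
  rw [real_inner_smul_left, norm_smul, mul_pow, Real.norm_eq_abs, sq_abs] at h2
  have h3 : g * ‖A (u t)‖ ^ 2 / a * w ≤ K / w := by
    rw [div_mul_eq_mul_div, div_le_div_iff₀ hat hw]
    refine le_trans ?_ hd
    calc _ = g * ‖A (u t)‖ ^ 2 * (w * w) := by ring
      _ ≤ _ := by gcongr
  have h4 : 2 * γ * ε * (g * ‖A (u t)‖ ^ 2 / a * w) ≤ 1 / 2 / w := by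
    calc _ ≤ 2 * γ * ε * (K / w) := by gcongr
      _ = (4 * γ * K * ε) / 2 / w := by ring
      _ ≤ _ := by gcongr
  have h5 := mul_le_mul_of_nonneg_right h4 (sq_nonneg ‖η‖)
  have h6 : 2 * (-‖η‖ ^ 2 / w - ⟪m, η⟫ - ε * ⟪v' t, η⟫)
      + 2 * γ * ε * (g * ‖A (u t)‖ ^ 2 / a * w) * ‖η‖ ^ 2
      ≤ -(‖η‖ ^ 2 / w) + 4 * (w * ‖m‖ ^ 2) + 4 * ε ^ 2 * (w * ‖v' t‖ ^ 2) := by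
    have e1 : ‖η‖ ^ 2 / (4 * w) = ‖η‖ ^ 2 / w / 4 := by ring
    rw [e1] at h1 h2
    have e2 : 1 / 2 / w * ‖η‖ ^ 2 = ‖η‖ ^ 2 / w / 2 := by ring
    rw [e2] at h5
    have e3 : -‖η‖ ^ 2 / w = -(‖η‖ ^ 2 / w) := by ring
    rw [e3]
    linarith
  calc _ = (2 * (-‖η‖ ^ 2 / w - ⟪m, η⟫ - ε * ⟪v' t, η⟫)
      + 2 * γ * ε * (g * ‖A (u t)‖ ^ 2 / a * w) * ‖η‖ ^ 2) / g := by
        field_simp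
        ring
    _ ≤ (-(‖η‖ ^ 2 / w) + 4 * (w * ‖m‖ ^ 2) + 4 * ε ^ 2 * (w * ‖v' t‖ ^ 2)) / g := by gcongr
    _ = _ := by ring

end Residual

/-- The integral of a continuous function is bounded by the decrease of a Lyapunov functional. -/
theorem integral_le_of_deriv_le_neg {F F' φ : ℝ → ℝ}
    (hF : ∀ t, 0 ≤ t → HasDerivWithinAt F (F' t) (Set.Ici 0) t)
    (hφ : ContinuousOn φ (Set.Ici 0)) (hle : ∀ t, 0 ≤ t → F' t ≤ -φ t) {t : ℝ} (ht : 0 ≤ t) :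
    ∫ s in (0 : ℝ)..t, φ s ≤ F 0 - F t := by
  have := integral_le_sub_of_hasDeriv_right_of_le (g := fun t => -F t) (g' := fun t => -F' t)
    (φ := φ) ht
    (fun s hs => ((hF s hs.1).continuousWithinAt.mono Set.Icc_subset_Ici_self).neg)
    (fun s hs => ((hF s hs.1.le).mono (Set.Ioi_subset_Ici hs.1.le)).neg)
    ((hφ.mono Set.Icc_subset_Ici_self).integrableOn_Icc)
    (fun s hs => by have := hle s hs.1.le; linarith)
  linarith

/-- Global-in-time error estimate (part 1 of Theorem 2.2): with `ρ_ε = u_ε - u` and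
`r_ε = u_ε - u - θ_ε`, one has
`|ρ_ε(t)|² + ⟨Aρ_ε(t),ρ_ε(t)⟩ + ∫₀ᵗ |r_ε'|² ⟨Au,u⟩^{-γ} (1+s)^{-p} ds ≤ C₃ ε`. -/
theorem globalErrorEstimate
    {H : Type*} [NormedAddCommGroup H] [InnerProductSpace ℝ H] [CompleteSpace H]
    (A : H →L[ℝ] H)
    (hA_sa : ∀ x y : H, ⟪A x, y⟫ = ⟪x, A y⟫)
    (hA_nn : ∀ x : H, 0 ≤ ⟪A x, x⟫)
    (p γ : ℝ) (hp0 : 0 ≤ p) (hp1 : p ≤ 1) (hγ : 1 ≤ γ)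
    (u₀ u₁ : H) (hmdg : 0 < ⟪A u₀, u₀⟫)
    (u u' : ℝ → H) (hu : IsParSolution A p γ u₀ u u') :
    ∃ ε₀ > 0, ∃ C₃ > 0, ∀ ε : ℝ, 0 < ε → ε < ε₀ →
      ∀ uε uε' uε'' : ℝ → H, IsHypSolution A p γ ε u₀ u₁ uε uε' uε'' →
      ∀ θ θ' θ'' : ℝ → H,
        IsCorrector p ε (u₁ + (⟪A u₀, u₀⟫ ^ γ) • A u₀) θ θ' θ'' →
      ∀ t ∈ Set.Ici (0:ℝ),
        ‖uε t - u t‖ ^ 2 + ⟪A (uε t - u t), uε t - u t⟫ +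
          ∫ s in (0:ℝ)..t,
            ‖uε' s - u' s - θ' s‖ ^ 2 * ⟪A (u s), u s⟫ ^ (-γ) * (1+s) ^ (-p)
        ≤ C₃ * ε := by
  obtain ⟨ε₁, hε₁, C, hC, hyp⟩ := exists_hyp_estimates hA_sa hA_nn hp0 hp1 hγ u₀ u₁ hmdg
  obtain ⟨K, hK, par, v', Θ, Θ', hv, hΘd, hΘ', hΘ⟩ :=
    hu.exists_estimates hA_sa hA_nn hp0 hp1 hγ hmdg
  set D := ‖A‖ * (2 + 80 * (γ * 4 ^ γ) ^ 2) + 8 * K * C with hD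
  have hDpos : 0 < D := by positivity
  set E := C + ‖u₀‖ ^ 2 + 4 * C ^ 2 + (K + 1) / 2 * ‖u₀‖ ^ 2 with hE
  have hΘ_zero := hΘ 0 le_rfl
  refine ⟨min ε₁ (min (1 / 2) (1 / (4 * γ * K))), by positivity,
    (1 + ‖A‖) * (8 * (E + 2 * C ^ 2)) + (16 * D * (E + 2 * C ^ 2) + 4 * Θ 0), by positivity,
    fun ε hε hεε x x' x'' hx θ θ' θ'' hθ t ht => ?_⟩
  have hε1 : ε ≤ 1 / 2 :=
    (hεε.trans_le ((min_le_right _ _).trans (min_le_left _ _))).le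
  have hεK : 4 * γ * K * ε ≤ 1 := by
    have := (hεε.trans_le ((min_le_right _ _).trans (min_le_right _ _))).le
    rw [le_div_iff₀ (by positivity)] at this
    linarith
  obtain ⟨hest, J, J', hJd, hJ', hJ, hJ0⟩ := hyp ε hε (hεε.trans_le (min_le_left _ _)) x x' x'' hx
  obtain ⟨F, F', hFd, hF', hFlow, hF0⟩ := exists_difference_energy hA_sa hA_nn hp0 hp1 hγ hx hu hε
    hε1 hC hK (fun t ht => (hest t ht).2.2.1) (fun t ht => (hest t ht).2.2.2.1)
    (fun t ht => (hest t ht).2.2.2.2) (fun t ht => (par t ht).2.2.2) hJd hJ' hJ hJ0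
  obtain ⟨R', hRd, hR'⟩ := exists_residual_energy hε (by linarith) hA_sa hA_nn hp0 hp1 hx hu hθ hv
    hεK (fun t ht => (par t ht).1) (fun t ht => (par t ht).2.1)
  have hg : ∀ t, 0 ≤ t → 0 < ⟪A (u t), u t⟫ ^ γ := fun t ht =>
    Real.rpow_pos_of_pos (par t ht).1 γ
  have hw : ∀ t : ℝ, 0 ≤ t → (0 : ℝ) < (1 + t) ^ p := fun t ht =>
    Real.rpow_pos_of_pos (by linarith) p
  have hM : ∀ t, 0 ≤ t →
      (1 + t) ^ p * ‖⟪A (x t), x t⟫ ^ γ • A (x t) - ⟪A (u t), u t⟫ ^ γ • A (u t)‖ ^ 2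
          / ⟪A (u t), u t⟫ ^ γ
        ≤ 2 * D * ((1 + t) ^ p *
          ⟪⟪A (x t), x t⟫ ^ γ • A (x t) - ⟪A (u t), u t⟫ ^ γ • A (u t), x t - u t⟫) ∧
      0 ≤ (1 + t) ^ p *
          ⟪⟪A (x t), x t⟫ ^ γ • A (x t) - ⟪A (u t), u t⟫ ^ γ • A (u t), x t - u t⟫ :=
      fun t ht => by
    have hco := half_mul_inner_le_inner_sub hA_sa hA_nn (by linarith : 0 ≤ γ) (x t) (u t)
    have hup := norm_sq_rpow_smul_sub_le hA_sa hA_nn hγ hC.le hK.le (hest t ht).1 (par t ht).1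
      (hest t ht).2.1 (par t ht).2.2.1
    have hgt := hg t ht
    have hwt := hw t ht
    have hgx : 0 < ⟪A (x t), x t⟫ ^ γ := Real.rpow_pos_of_pos (hest t ht).1 γ
    have hd := hA_nn (x t - u t)
    refine ⟨?_, mul_nonneg hwt.le (le_trans (by positivity) hco)⟩
    rw [div_le_iff₀ hgt]
    have h1 := mul_le_mul_of_nonneg_left hup hwt.le
    have h2 := mul_le_mul_of_nonneg_left hco
      (by positivity : 0 ≤ 2 * D * (1 + t) ^ p * ⟪A (u t), u t⟫ ^ γ)
    linarith
  have hFle : ∀ t, 0 ≤ t → F t ≤ E * ε := fun t ht =>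
    (le_initial_of_deriv_nonpos_Ici hFd
      (fun s hs => (hF' s hs).trans (by linarith [(hM s hs).2])) ht).trans hF0
  have hρ : ‖x t - u t‖ ^ 2 ≤ 8 * (E + 2 * C ^ 2) * ε := by
    have h1 := hFlow t ht
    have h2 := hFle t ht
    linarith
  have hintegral : ∫ s in (0:ℝ)..t,
      ‖x' s - u' s - θ' s‖ ^ 2 * ⟪A (u s), u s⟫ ^ (-γ) * (1+s) ^ (-p)
      ≤ (16 * D * (E + 2 * C ^ 2) + 4 * Θ 0) * ε := by
    have hφeq : ∀ s, 0 ≤ s → ‖x' s - u' s - θ' s‖ ^ 2 * ⟪A (u s), u s⟫ ^ (-γ) * (1+s) ^ (-p)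
        = ‖x' s - u' s - θ' s‖ ^ 2 / ⟪A (u s), u s⟫ ^ γ / (1 + s) ^ p := fun s hs => by
      rw [Real.rpow_neg (hA_nn _), Real.rpow_neg (by linarith), div_eq_mul_inv, div_eq_mul_inv]
    have hφc : ContinuousOn
        (fun s => ‖x' s - u' s - θ' s‖ ^ 2 * ⟪A (u s), u s⟫ ^ (-γ) * (1+s) ^ (-p))
        (Set.Ici 0) := by
      refine ContinuousOn.congr (fun s hs => ?_) hφeq
      exact (hRd s hs).continuousWithinAt.div
        (hasDerivWithinAt_one_add_rpow p hs).continuousWithinAt (hw s hs).ne'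
    have key := integral_le_of_deriv_le_neg
      (F := fun t => ε * (‖x' t - u' t - θ' t‖ ^ 2 / ⟪A (u t), u t⟫ ^ γ) + 16 * D * F t
        + 4 * ε ^ 2 * Θ t)
      (fun t ht => (((hRd t ht).const_mul ε).fun_add ((hFd t ht).const_mul _)).fun_add
        ((hΘd t ht).const_mul _)) hφc (fun s hs => by
        rw [hφeq s hs]
        have h1 := hR' s hs
        have h2 := (hM s hs).1
        have h3 := mul_le_mul_of_nonneg_left (hF' s hs) (by positivity : 0 ≤ 16 * D)
        have h4 := mul_le_mul_of_nonneg_left (hΘ' s hs) (by positivity : 0 ≤ 4 * ε ^ 2)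
        linarith) ht
    have hη0 : x' 0 - u' 0 - θ' 0 = 0 := by
      rw [hx.2.1, hθ.2.1, hu.velocity_eq le_rfl, hu.1, add_zero, Real.one_rpow, one_mul, neg_smul]
      abel
    have hη_sq : ε * (‖x' 0 - u' 0 - θ' 0‖ ^ 2 / ⟪A (u 0), u 0⟫ ^ γ) = 0 := by simp [hη0]
    refine key.trans ?_
    have hF_zero : F 0 ≤ E * ε := hF0
    have h1 : 0 ≤ ε * (‖x' t - u' t - θ' t‖ ^ 2 / ⟪A (u t), u t⟫ ^ γ) := by
      have := hg t ht
      positivity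
    have h2 : 0 ≤ 4 * ε ^ 2 * Θ t := mul_nonneg (by positivity) (hΘ t ht)
    have h3 : 0 ≤ F t + 2 * C ^ 2 * ε := by
      have := hFlow t ht
      have := sq_nonneg ‖x t - u t‖
      linarith
    have h4 := mul_le_mul_of_nonneg_left h3 (by positivity : 0 ≤ 16 * D)
    have h5 := mul_le_mul_of_nonneg_left hF_zero (by positivity : 0 ≤ 16 * D)
    have h6 : ε ^ 2 * Θ 0 ≤ ε * Θ 0 := by
      have : ε ^ 2 ≤ ε := by nlinarith
      gcongr
    rw [hη_sq]
    linarith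
  have hd := inner_map_self_le (A := A) (x t - u t)
  have := mul_le_mul_of_nonneg_left hρ (norm_nonneg A)
  linarith
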